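/- arXiv:1409.4076 — 2 statements merged into one kernel-verified Lean document; each statement's English description precedes it below -/
import Mathlib

section
/- Let $1<p<\infty$, $0<q<p-1$, $0<\alpha<n/p$, and $\sigma$ a nonnegative locally finite Borel measure on $\mathbb{R}^n$. Suppose $u\ge 0$, $u\in L^q_{loc}(d\sigma)$, is nontrivial and satisfies $u\ge\mathbf{W}_{\alpha,p}(u^q\,d\sigma)$ $\sigma$-a.e. Then for all $x\in\mathbb{R}^n$ and $t>0$, $\sigma(B(x,t))\left[\int_t^\infty\left(\kappa(B(x,s))^{q(p-1)/(p-1-q)}/s^{n-\alpha p}\right)^{1/(p-1)}\,ds/s\right]^q \le c\int_{B(x,t)}u^q\,d\sigma$, where $\kappa(B)$ is the least constant in $\|\mathbf{W}_{\alpha,p}\nu\|_{L^q(\sigma|_B)}\le\kappa(B)\nu(\mathbb{R}^n)^{1/(p-1)}$ and $c=c(n,p,q,\alpha)$. -/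
open MeasureTheory ENNReal

noncomputable def wolffTail (n : ℕ) (p α : ℝ)
    (σ : Measure (EuclideanSpace ℝ (Fin n))) (x : EuclideanSpace ℝ (Fin n)) (R : ℝ) : ℝ≥0∞ :=
  ∫⁻ r in Set.Ioi R,
    (σ (Metric.ball x r) / ENNReal.ofReal (r ^ ((n : ℝ) - α * p))) ^ (1 / (p - 1))
      / ENNReal.ofReal r

noncomputable def wolff (n : ℕ) (p α : ℝ)
    (σ : Measure (EuclideanSpace ℝ (Fin n))) (x : EuclideanSpace ℝ (Fin n)) : ℝ≥0∞ :=
  wolffTail n p α σ x 0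

noncomputable def kappa (n : ℕ) (p α q : ℝ) (σ : Measure (EuclideanSpace ℝ (Fin n)))
    (B : Set (EuclideanSpace ℝ (Fin n))) : ℝ≥0∞ :=
  sInf {κ : ℝ≥0∞ | ∀ ν : Measure (EuclideanSpace ℝ (Fin n)), IsFiniteMeasure ν →
    (∫⁻ x in B, wolff n p α ν x ^ q ∂σ) ^ (1 / q) ≤ κ * (ν Set.univ) ^ (1 / (p - 1))}

noncomputable def kappaTail (n : ℕ) (p α q : ℝ) (σ : Measure (EuclideanSpace ℝ (Fin n)))
    (x : EuclideanSpace ℝ (Fin n)) (t : ℝ) : ℝ≥0∞ :=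
  ∫⁻ s in Set.Ioi t,
    (kappa n p α q σ (Metric.ball x s) ^ (q * (p - 1) / (p - 1 - q))
      / ENNReal.ofReal (s ^ ((n : ℝ) - α * p))) ^ (1 / (p - 1)) / ENNReal.ofReal s


lemma weak_type {E : Type*} [MetricSpace E] [SecondCountableTopology E] [MeasurableSpace E]
    [OpensMeasurableSpace E] {N : ℕ} {τ : ℝ} (hτ : 1 < τ)
    (hN : IsEmpty (Besicovitch.SatelliteConfig E N τ)) (ω ν : Measure E) (l : ℝ≥0∞) :
    l * ω {x | ∃ r, 0 < r ∧ l * ω (Metric.ball x r) < ν (Metric.ball x r)} ≤ N * ν Set.univ := by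
  have key : ∀ R : ℕ, l * ω {x | ∃ r, 0 < r ∧ r ≤ (R : ℝ) ∧
      l * ω (Metric.closedBall x r) < ν (Metric.closedBall x r)} ≤ N * ν Set.univ := by
    intro R
    set A := {x | ∃ r, 0 < r ∧ r ≤ (R : ℝ) ∧
      l * ω (Metric.closedBall x r) < ν (Metric.closedBall x r)} with hA
    have hx : ∀ x : A, ∃ r, 0 < r ∧ r ≤ (R : ℝ) ∧
      l * ω (Metric.closedBall (x : E) r) < ν (Metric.closedBall (x : E) r) := fun x => x.2
    choose r hr0 hrR hr using hx
    obtain ⟨s, hs, hcov⟩ := Besicovitch.exist_disjoint_covering_families hτ hN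
      (⟨fun x : A => (x : E), r, hr0, R, hrR⟩ : Besicovitch.BallPackage A E)
    simp only at hs hcov
    have hcount : ∀ i, (s i).Countable := by
      intro i
      refine (hs i).countable_of_nonempty_interior fun j _ => ?_
      exact ⟨j, Metric.ball_subset_interior_closedBall (Metric.mem_ball_self (hr0 j))⟩
    have h1 : ω A ≤ ∑ i : Fin N, ∑' j : s i, ω (Metric.closedBall ((j : A) : E) (r j)) := by
      calc ω A ≤ ω (⋃ i : Fin N, ⋃ j ∈ s i, Metric.closedBall ((j : A) : E) (r j)) := by
            apply measure_mono
            intro x hx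
            have := hcov (⟨⟨x, hx⟩, rfl⟩ : x ∈ Set.range fun x : A => (x : E))
            simp only [Set.mem_iUnion] at this ⊢
            obtain ⟨i, j, hj, hxj⟩ := this
            exact ⟨i, j, hj, Metric.ball_subset_closedBall hxj⟩
        _ ≤ ∑ i : Fin N, ω (⋃ j ∈ s i, Metric.closedBall ((j : A) : E) (r j)) :=
            measure_iUnion_fintype_le _ _
        _ ≤ _ := Finset.sum_le_sum fun i _ => measure_biUnion_le _ (hcount i) _
    calc l * ω A ≤ l * ∑ i : Fin N, ∑' j : s i, ω (Metric.closedBall ((j : A) : E) (r j)) := by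
          gcongr
      _ = ∑ i : Fin N, ∑' j : s i, l * ω (Metric.closedBall ((j : A) : E) (r j)) := by
          rw [Finset.mul_sum]; simp_rw [ENNReal.tsum_mul_left]
      _ ≤ ∑ i : Fin N, ∑' j : s i, ν (Metric.closedBall ((j : A) : E) (r j)) :=
          Finset.sum_le_sum fun i _ => ENNReal.tsum_le_tsum fun j => (hr j).le
      _ = ∑ i : Fin N, ν (⋃ j ∈ s i, Metric.closedBall ((j : A) : E) (r j)) := by
          refine Finset.sum_congr rfl fun i _ => ?_
          rw [measure_biUnion (hcount i) (hs i) fun j _ => Metric.isClosed_closedBall.measurableSet]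
      _ ≤ ∑ i : Fin N, ν Set.univ := Finset.sum_le_sum fun i _ => measure_mono (Set.subset_univ _)
      _ = N * ν Set.univ := by simp
  have hmono : Monotone fun R : ℕ => {x | ∃ r, 0 < r ∧ r ≤ (R : ℝ) ∧
      l * ω (Metric.closedBall x r) < ν (Metric.closedBall x r)} := by
    rintro a b hab x ⟨r, h0, h1, h2⟩
    exact ⟨r, h0, h1.trans (by exact_mod_cast hab), h2⟩
  have hsub : {x | ∃ r, 0 < r ∧ l * ω (Metric.ball x r) < ν (Metric.ball x r)} ⊆
      ⋃ R : ℕ, {x | ∃ r, 0 < r ∧ r ≤ (R : ℝ) ∧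
      l * ω (Metric.closedBall x r) < ν (Metric.closedBall x r)} := by
    rintro x ⟨r, hr0, hr⟩
    have hU : Metric.ball x r = ⋃ k : ℕ, Metric.closedBall x (r - r / (k + 2)) := by
      ext y
      simp only [Metric.mem_ball, Set.mem_iUnion, Metric.mem_closedBall]
      constructor
      · intro hy
        obtain ⟨k, hk⟩ := exists_nat_gt (r / (r - dist y x))
        refine ⟨k, ?_⟩
        have hd : 0 < r - dist y x := by linarith
        rw [div_lt_iff₀ hd] at hk
        have : r / (k + 2) ≤ r - dist y x := by
          rw [div_le_iff₀ (by positivity)]; nlinarith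
        linarith
      · rintro ⟨k, hk⟩
        have : 0 < r / ((k : ℝ) + 2) := by positivity
        linarith
    have hm : Monotone fun k : ℕ => Metric.closedBall x (r - r / ((k : ℝ) + 2)) := by
      intro a b hab
      apply Metric.closedBall_subset_closedBall
      have : (a : ℝ) ≤ b := by exact_mod_cast hab
      gcongr
    have hr' := hr
    rw [hU, hm.measure_iUnion (μ := ν), ← hU] at hr'
    obtain ⟨k, hk⟩ := lt_iSup_iff.1 hr'
    obtain ⟨R, hR⟩ := exists_nat_ge (r - r / ((k : ℝ) + 2))
    refine Set.mem_iUnion.2 ⟨R, r - r / ((k : ℝ) + 2), ?_, hR, lt_of_le_of_lt ?_ hk⟩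
    · have : r / ((k : ℝ) + 2) < r := by
        apply div_lt_self hr0
        have : (0 : ℝ) ≤ k := by positivity
        linarith
      linarith
    · gcongr
      rw [hU]
      exact Set.subset_iUnion (fun k : ℕ => Metric.closedBall x (r - r / ((k : ℝ) + 2))) k
  calc _ ≤ l * ω (⋃ R : ℕ, {x | ∃ r, 0 < r ∧ r ≤ (R : ℝ) ∧
      l * ω (Metric.closedBall x r) < ν (Metric.closedBall x r)}) := by gcongr
    _ ≤ _ := by
      rw [hmono.measure_iUnion, ENNReal.mul_iSup]
      exact iSup_le key

lemma wolff_le (n : ℕ) (p α : ℝ) (hp : 1 < p) (ω ν : Measure (EuclideanSpace ℝ (Fin n)))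
    (x : EuclideanSpace ℝ (Fin n)) (l : ℝ≥0∞) (hl : l ≠ ⊤)
    (h : ∀ r, 0 < r → ν (Metric.ball x r) ≤ l * ω (Metric.ball x r)) :
    wolff n p α ν x ≤ l ^ (1 / (p - 1)) * wolff n p α ω x := by
  have hg : 0 ≤ 1 / (p - 1) := by apply one_div_nonneg.2; linarith
  unfold wolff wolffTail
  rw [← lintegral_const_mul' _ _ (ENNReal.rpow_ne_top_of_nonneg hg hl)]
  apply setLIntegral_mono' measurableSet_Ioi
  intro r hr
  rw [← mul_div_assoc, ← ENNReal.mul_rpow_of_nonneg _ _ hg, ← mul_div_assoc]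
  gcongr
  exact h r hr

/-- the layer-cake bound -/
lemma layer_bound {E : Type*} [MetricSpace E] [SecondCountableTopology E] [MeasurableSpace E]
    [OpensMeasurableSpace E] {N : ℕ} {τ : ℝ} (hτ : 1 < τ)
    (hN : IsEmpty (Besicovitch.SatelliteConfig E N τ)) (ω ν : Measure E) (l : ℝ≥0∞)
    (hl0 : l ≠ 0) (hl : l ≠ ⊤) (s : ℝ) (B : Set E) :
    ∫⁻ x in B, (l ^ s + ∑' k : ℕ, (toMeasurable ω {x | ∃ r, 0 < r ∧
        (l * 2 ^ k) * ω (Metric.ball x r) < ν (Metric.ball x r)}).indicator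
          (fun _ => (l * 2 ^ (k + 1)) ^ s) x) ∂ω
      ≤ l ^ s * ω B + l ^ (s - 1) * (2 ^ s * (1 - 2 ^ (s - 1))⁻¹ * N) * ν Set.univ := by
  rw [lintegral_add_left measurable_const, lintegral_tsum]
  swap
  · intro k
    exact (measurable_const.indicator (measurableSet_toMeasurable _ _)).aemeasurable
  gcongr
  · simp
  have hk : ∀ k : ℕ, ∫⁻ x in B, (toMeasurable ω {x | ∃ r, 0 < r ∧
        (l * 2 ^ k) * ω (Metric.ball x r) < ν (Metric.ball x r)}).indicator
          (fun _ => (l * 2 ^ (k + 1)) ^ s) x ∂ω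
      ≤ (2 ^ (s - 1)) ^ k * (l ^ (s - 1) * (2 ^ s * N * ν Set.univ)) := by
    intro k
    have hw := weak_type hτ hN ω ν (l * 2 ^ k)
    set A := {x | ∃ r, 0 < r ∧
        (l * 2 ^ k) * ω (Metric.ball x r) < ν (Metric.ball x r)} with hA
    have h0 : l * 2 ^ k ≠ 0 := by simp [hl0]
    have h1 : l * 2 ^ k ≠ ⊤ := ENNReal.mul_ne_top hl (by simp)
    calc _ ≤ (l * 2 ^ (k + 1)) ^ s * ω A := by
          rw [lintegral_indicator_const (measurableSet_toMeasurable _ _)]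
          exact mul_le_mul' le_rfl
            ((Measure.restrict_apply_le B _).trans (measure_toMeasurable A).le)
      _ = 2 ^ s * (l * 2 ^ k) ^ (s - 1) * ((l * 2 ^ k) * ω A) := by
          have e1 : (l * 2 ^ (k + 1)) ^ s = 2 ^ s * (l * 2 ^ k) ^ s := by
            rw [← ENNReal.mul_rpow_of_ne_top (by simp) h1]
            congr 1; ring
          have e2 : (l * 2 ^ k) ^ s = (l * 2 ^ k) ^ (s - 1) * (l * 2 ^ k) := by
            conv_rhs => rw [← ENNReal.rpow_one (l * 2 ^ k), ← ENNReal.rpow_mul, one_mul,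
              ← ENNReal.rpow_add _ _ h0 h1]
            congr 1; ring
          rw [e1, e2]; ring
      _ ≤ 2 ^ s * (l * 2 ^ k) ^ (s - 1) * (N * ν Set.univ) := by gcongr
      _ = _ := by
          rw [ENNReal.mul_rpow_of_ne_top hl (by simp), ← ENNReal.rpow_natCast 2 k,
            ← ENNReal.rpow_mul, ← ENNReal.rpow_natCast _ k, ← ENNReal.rpow_mul, mul_comm (k : ℝ)]
          ring
  calc _ ≤ ∑' k : ℕ, (2 ^ (s - 1)) ^ k * (l ^ (s - 1) * (2 ^ s * N * ν Set.univ)) :=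
        ENNReal.tsum_le_tsum hk
    _ = _ := by rw [ENNReal.tsum_mul_right, ENNReal.tsum_geometric]; ring
    _ ≤ _ := le_rfl

/-- pointwise bound -/
lemma pointwise_bound (n : ℕ) (p q α : ℝ) (hp : 1 < p) (hq0 : 0 < q)
    (ω ν : Measure (EuclideanSpace ℝ (Fin n)))
    (x : EuclideanSpace ℝ (Fin n)) (l v : ℝ≥0∞) (hl0 : l ≠ 0) (hl : l ≠ ⊤)
    (hv0 : v ≠ 0) (hv : wolff n p α ω x ≤ v) :
    wolff n p α ν x ^ q ≤ v ^ q * (l ^ (q / (p - 1)) +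
      ∑' k : ℕ, (toMeasurable ω {x | ∃ r, 0 < r ∧
        (l * 2 ^ k) * ω (Metric.ball x r) < ν (Metric.ball x r)}).indicator
          (fun _ => (l * 2 ^ (k + 1)) ^ (q / (p - 1))) x) := by
  have hp1 : 0 < p - 1 := by linarith
  have hs : 0 < q / (p - 1) := by positivity
  set A : ℕ → Set (EuclideanSpace ℝ (Fin n)) := fun k => {x | ∃ r, 0 < r ∧
        (l * 2 ^ k) * ω (Metric.ball x r) < ν (Metric.ball x r)} with hA
  have hnot : ∀ k, x ∉ A k → wolff n p α ν x ^ q ≤ v ^ q * (l * 2 ^ k) ^ (q / (p - 1)) := by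
    intro k hk
    have h1 : l * 2 ^ k ≠ ⊤ := ENNReal.mul_ne_top hl (by simp)
    have := wolff_le n p α hp ω ν x (l * 2 ^ k) h1 (by
      intro r hr
      by_contra hcon
      exact hk ⟨r, hr, not_le.1 hcon⟩)
    calc wolff n p α ν x ^ q ≤ ((l * 2 ^ k) ^ (1 / (p - 1)) * v) ^ q := by
          gcongr
          exact this.trans (by gcongr)
      _ = _ := by
          rw [ENNReal.mul_rpow_of_nonneg _ _ hq0.le, ← ENNReal.rpow_mul, mul_comm]
          congr 2; ring
  by_cases hall : ∀ k, x ∈ A k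
  · have : ∑' k : ℕ, (toMeasurable ω (A k)).indicator
          (fun _ => (l * 2 ^ (k + 1)) ^ (q / (p - 1))) x = ⊤ := by
      rw [eq_top_iff, ← ENNReal.tsum_const_eq_top_of_ne_zero (α := ℕ) (c := l ^ (q / (p - 1)))
        (by simp [ENNReal.rpow_eq_zero_iff, hl0, hl])]
      apply ENNReal.tsum_le_tsum
      intro k
      rw [Set.indicator_of_mem (subset_toMeasurable _ _ (hall k))]
      gcongr
      exact le_mul_of_one_le_right' (one_le_pow₀ (by norm_num))
    rw [this, add_top, ENNReal.mul_top]
    · exact le_top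
    · simp [ENNReal.rpow_eq_zero_iff, hv0, hq0.le]
  · push Not at hall
    classical
    obtain ⟨k, hk, hmin⟩ : ∃ k, x ∉ A k ∧ ∀ j < k, x ∈ A j :=
      ⟨Nat.find hall, Nat.find_spec hall, fun j hj => not_not.1 (Nat.find_min hall hj)⟩
    refine (hnot k hk).trans ?_
    gcongr
    rcases k with _ | k
    · simp
    · refine le_trans ?_ le_add_self
      refine le_trans ?_ (ENNReal.le_tsum k)
      rw [Set.indicator_of_mem (subset_toMeasurable _ _ (hmin k (Nat.lt_succ_self k)))]

lemma tail_le (n : ℕ) (p α : ℝ) (hp : 1 < p) (ω : Measure (EuclideanSpace ℝ (Fin n)))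
    (x y : EuclideanSpace ℝ (Fin n)) (t : ℝ) (ht : 0 < t) (hy : y ∈ Metric.ball x t) :
    wolffTail n p α ω x t ≤
      ENNReal.ofReal (2 ^ ((n : ℝ) - α * p)) ^ (1 / (p - 1)) * wolff n p α ω y := by
  have hg : 0 ≤ 1 / (p - 1) := by apply one_div_nonneg.2; linarith
  set m := (n : ℝ) - α * p with hm
  set D := ENNReal.ofReal (2 ^ m) ^ (1 / (p - 1)) with hD
  have hDt : D ≠ ⊤ := ENNReal.rpow_ne_top_of_nonneg hg ENNReal.ofReal_ne_top
  set F : ℝ → ℝ≥0∞ := (Set.Ioi 0).indicator fun r =>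
    (ω (Metric.ball y r) / ENNReal.ofReal (r ^ m)) ^ (1 / (p - 1)) / ENNReal.ofReal r with hF
  have hw : wolff n p α ω y = ∫⁻ r, F r := by
    rw [hF, lintegral_indicator measurableSet_Ioi]; rfl
  have hscale : ∫⁻ r, F r = ∫⁻ s, 2 * F (2 * s) := by
    rw [lintegral_const_mul' _ _ (by simp)]
    have h2 : (2 : ℝ) ≠ 0 := two_ne_zero
    have := Real.smul_map_volume_mul_left h2
    conv_lhs => rw [← this]
    rw [lintegral_smul_measure]
    have e := lintegral_map_equiv (μ := volume) F (Homeomorph.mulLeft₀ (2 : ℝ) h2).toMeasurableEquiv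
    simp only [Homeomorph.toMeasurableEquiv_coe, Homeomorph.coe_mulLeft₀] at e
    rw [e]; simp
  rw [hw, hscale, ← lintegral_const_mul' _ _ hDt]
  unfold wolffTail
  refine le_trans (setLIntegral_mono' measurableSet_Ioi ?_) (setLIntegral_le_lintegral (Set.Ioi t) _)
  intro s hs
  have hs0 : 0 < s := ht.trans hs
  have h2s : (2 * s) ∈ Set.Ioi (0 : ℝ) := by simp [hs0]
  rw [hF, Set.indicator_of_mem h2s, ENNReal.ofReal_mul (by norm_num),
    Real.mul_rpow (by norm_num) hs0.le, ENNReal.ofReal_mul (by positivity), ENNReal.ofReal_ofNat]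
  have hsub : ω (Metric.ball x s) ≤ ω (Metric.ball y (2 * s)) := by
    apply measure_mono
    apply Metric.ball_subset_ball'
    rw [dist_comm]
    have : dist y x < t := hy
    have : t < s := hs
    linarith
  have a0 : ENNReal.ofReal (2 ^ m) ≠ 0 := by simp; positivity
  have e1 : D * (ω (Metric.ball y (2 * s)) / (ENNReal.ofReal (2 ^ m) * ENNReal.ofReal (s ^ m))) ^ (1 / (p - 1)) =
      (ω (Metric.ball y (2 * s)) / ENNReal.ofReal (s ^ m)) ^ (1 / (p - 1)) := by
    rw [hD, ← ENNReal.mul_rpow_of_nonneg _ _ hg, ← mul_div_assoc,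
      ENNReal.mul_div_mul_left _ _ a0 ENNReal.ofReal_ne_top]
  have e2 : D * (2 * ((ω (Metric.ball y (2 * s)) / (ENNReal.ofReal (2 ^ m) * ENNReal.ofReal (s ^ m))) ^ (1 / (p - 1)) / (2 * ENNReal.ofReal s)))
     = (ω (Metric.ball y (2 * s)) / ENNReal.ofReal (s ^ m)) ^ (1 / (p - 1)) / ENNReal.ofReal s := by
    rw [← mul_div_assoc 2, ENNReal.mul_div_mul_left _ _ (by simp) (by simp), ← mul_div_assoc, e1]
  show _ ≤ D * (2 * ((ω (Metric.ball y (2 * s)) / (ENNReal.ofReal (2 ^ m) * ENNReal.ofReal (s ^ m))) ^ (1 / (p - 1)) / (2 * ENNReal.ofReal s)))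
  rw [e2]
  gcongr

lemma wolff_zero (n : ℕ) (p α : ℝ) (hp : 1 < p) (x : EuclideanSpace ℝ (Fin n)) :
    wolff n p α 0 x = 0 := by
  have : 0 < (p - 1)⁻¹ := by apply inv_pos.2; linarith
  simp [wolff, wolffTail, this]

lemma wolff_pos (n : ℕ) (p α : ℝ) (hp : 1 < p) (ω : Measure (EuclideanSpace ℝ (Fin n)))
    (hω : ω ≠ 0) (x : EuclideanSpace ℝ (Fin n)) : wolff n p α ω x ≠ 0 := by
  have hg : 0 < 1 / (p - 1) := by apply one_div_pos.2; linarith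
  obtain ⟨R, hR⟩ : ∃ R : ℕ, ω (Metric.ball x R) ≠ 0 := by
    by_contra! h
    apply hω
    rw [← Measure.measure_univ_eq_zero, ← Metric.iUnion_ball_nat x]
    exact measure_iUnion_null h
  set m := (n : ℝ) - α * p with hm
  intro h0
  -- lower bound on `(R+1, R+2)`
  set R' : ℝ := (R : ℝ) + 1
  have hR' : 0 < R' := by positivity
  have hmeas : Measurable fun r : ℝ => (ω (Metric.ball x r) / ENNReal.ofReal (r ^ m)) ^ (1 / (p - 1))
      / ENNReal.ofReal r := by
    have : Measurable fun r : ℝ => ω (Metric.ball x r) :=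
      Monotone.measurable fun a b hab => measure_mono (Metric.ball_subset_ball hab)
    exact ((this.div (Measurable.ennreal_ofReal (measurable_id.pow_const m))).pow_const _).div
      ENNReal.measurable_ofReal
  unfold wolff wolffTail at h0
  rw [lintegral_eq_zero_iff hmeas, Filter.EventuallyEq, ae_restrict_iff' measurableSet_Ioi] at h0
  have hbad : volume (Set.Ioi R') = 0 := by
    refine measure_mono_null ?_ h0
    intro r hr hcon
    have hr0 : 0 < r := hR'.trans hr
    have hc := hcon hr0
    have hb : ω (Metric.ball x r) ≠ 0 := fun h => hR (measure_mono_null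
      (Metric.ball_subset_ball (by have : R' < r := hr; simp only [R'] at this; linarith)) h)
    simp only [Pi.zero_apply, ENNReal.div_eq_zero_iff, ENNReal.ofReal_ne_top, or_false] at hc
    rw [ENNReal.rpow_eq_zero_iff_of_pos hg] at hc
    simp [hb] at hc
  simp at hbad

lemma kappa_bound (n : ℕ) (p q α : ℝ) (hp : 1 < p) (hq0 : 0 < q) (hq : q < p - 1)
    {N : ℕ} {τ : ℝ} (hτ : 1 < τ)
    (hN : IsEmpty (Besicovitch.SatelliteConfig (EuclideanSpace ℝ (Fin n)) N τ))
    (σ : Measure (EuclideanSpace ℝ (Fin n)))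
    (u : EuclideanSpace ℝ (Fin n) → ℝ≥0∞) (hu : Measurable u)
    (hpos : ∀ᵐ x ∂σ, u x ≠ 0)
    (hsup : ∀ᵐ x ∂σ, wolff n p α (σ.withDensity fun y => u y ^ q) x ≤ u x)
    (B : Set (EuclideanSpace ℝ (Fin n))) (hB : MeasurableSet B)
    (hfin : (σ.withDensity fun y => u y ^ q) B ≠ ⊤) :
    kappa n p α q σ B ^ (q * (p - 1) / (p - 1 - q)) ≤
      (1 + 2 ^ (q / (p - 1)) * (1 - 2 ^ (q / (p - 1) - 1))⁻¹ * N) ^ ((p - 1) / (p - 1 - q)) *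
        (σ.withDensity fun y => u y ^ q) B := by
  have hp1 : 0 < p - 1 := by linarith
  have hpq : 0 < p - 1 - q := by linarith
  have huq : Measurable fun y => u y ^ q := hu.pow_const q
  set ω := σ.withDensity fun y => u y ^ q with hω
  set s := q / (p - 1) with hs
  have hs0 : 0 < s := by positivity
  have hs1 : 0 < 1 - s := by
    rw [hs, sub_pos, div_lt_one hp1]; exact hq
  set K : ℝ≥0∞ := 2 ^ s * (1 - 2 ^ (s - 1))⁻¹ * N with hK
  have main : ∀ ν : Measure (EuclideanSpace ℝ (Fin n)), IsFiniteMeasure ν →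
      ∫⁻ x in B, wolff n p α ν x ^ q ∂σ ≤ (1 + K) * (ω B ^ (1 - s) * ν Set.univ ^ s) := by
    intro ν hν
    by_cases hν0 : ν = 0
    · subst hν0; simp [wolff_zero n p α hp, hq0]
    by_cases hb : ω B = 0
    · have hac : σ ≪ ω := by
        refine withDensity_absolutelyContinuous' huq.aemeasurable ?_
        filter_upwards [hpos] with x hx
        simp [ENNReal.rpow_eq_zero_iff, hx, hq0.le]
      have : σ B = 0 := hac hb
      simp [Measure.restrict_eq_zero.2 this]
    have ha0 : ν Set.univ ≠ 0 := by simpa using hν0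
    have ha : ν Set.univ ≠ ⊤ := measure_ne_top _ _
    set a := ν Set.univ
    set b := ω B
    set l := a / b with hl
    have hl0 : l ≠ 0 := by simp [hl, ha0, hfin]
    have hlt : l ≠ ⊤ := ENNReal.div_ne_top ha hb
    have hab : a = l * b := (ENNReal.div_mul_cancel hb hfin).symm
    have hpt := layer_bound hτ hN ω ν l hl0 hlt s B
    rw [hω, setLIntegral_withDensity_eq_setLIntegral_mul _ huq _ hB, ← hω] at hpt
    swap
    · refine measurable_const.add (Measurable.tsum fun k => ?_)
      exact measurable_const.indicator (measurableSet_toMeasurable _ _)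
    calc _ ≤ _ := by
          refine setLIntegral_mono_ae' hB ?_
          filter_upwards [hpos, hsup] with x h0 h1 _
          exact pointwise_bound n p q α hp hq0 ω ν x l (u x) hl0 hlt h0 h1
      _ ≤ _ := hpt
      _ = (1 + K) * (b ^ (1 - s) * a ^ s) := by
          have e1 : b ^ (1 - s) * a ^ s = l ^ s * b := by
            rw [hab, ENNReal.mul_rpow_of_nonneg _ _ hs0.le]
            have : b ^ (1 - s) * b ^ s = b := by
              rw [← ENNReal.rpow_add _ _ hb hfin]; simp
            calc _ = l ^ s * (b ^ (1 - s) * b ^ s) := by ring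
              _ = _ := by rw [this]
          have e2 : l ^ (s - 1) * a = l ^ s * b := by
            have : l ^ (s - 1) * l = l ^ s := by
              conv_lhs => rw [← ENNReal.rpow_one l, ← ENNReal.rpow_mul, one_mul,
                ← ENNReal.rpow_add _ _ hl0 hlt]
              congr 1; ring
            rw [← this, hab]; ring
          change l ^ s * b + l ^ (s - 1) * K * a = _
          rw [e1, add_mul, one_mul, ← e2]; ring
  have hk : kappa n p α q σ B ≤ ((1 + K) * ω B ^ (1 - s)) ^ (1 / q) := by
    apply sInf_le
    intro ν hν
    have hq' : 0 ≤ 1 / q := by positivity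
    calc _ ≤ ((1 + K) * (ω B ^ (1 - s) * ν Set.univ ^ s)) ^ (1 / q) := by
          gcongr; exact main ν hν
      _ = _ := by
          rw [← mul_assoc, ENNReal.mul_rpow_of_nonneg _ _ hq', ← ENNReal.rpow_mul (ν Set.univ)]
          congr 2
          rw [hs]; field_simp
  calc _ ≤ (((1 + K) * ω B ^ (1 - s)) ^ (1 / q)) ^ (q * (p - 1) / (p - 1 - q)) := by gcongr
    _ = _ := by
      have : 1 / q * (q * (p - 1) / (p - 1 - q)) = (p - 1) / (p - 1 - q) := by field_simp
      rw [← ENNReal.rpow_mul, this, ENNReal.mul_rpow_of_nonneg _ _ (by positivity),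
        ← ENNReal.rpow_mul]
      have : (1 - s) * ((p - 1) / (p - 1 - q)) = 1 := by rw [hs]; field_simp
      rw [this, ENNReal.rpow_one]

theorem kappa_tail_estimate (n : ℕ) (p q α : ℝ) (hp : 1 < p)
    (hq0 : 0 < q) (hq : q < p - 1) (hα0 : 0 < α) (hα : α < n / p) :
    ∃ c : ℝ≥0∞, 0 < c ∧ c ≠ ⊤ ∧
      ∀ (σ : Measure (EuclideanSpace ℝ (Fin n))), IsLocallyFiniteMeasure σ →
        ∀ u : EuclideanSpace ℝ (Fin n) → ℝ≥0∞, Measurable u →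
          (∀ (x : EuclideanSpace ℝ (Fin n)) (R : ℝ), 0 < R →
            ∫⁻ y in Metric.ball x R, u y ^ q ∂σ ≠ ⊤) →
          0 < ∫⁻ y, u y ^ q ∂σ →
          (∀ᵐ x ∂σ, wolff n p α (σ.withDensity fun y => u y ^ q) x ≤ u x) →
          ∀ (x : EuclideanSpace ℝ (Fin n)) (t : ℝ), 0 < t →
            σ (Metric.ball x t) * kappaTail n p α q σ x t ^ q
              ≤ c * ∫⁻ y in Metric.ball x t, u y ^ q ∂σ := by
  obtain ⟨N, τ, hτ, hN⟩ :=
    HasBesicovitchCovering.no_satelliteConfig (α := EuclideanSpace ℝ (Fin n))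
  have hp1 : 0 < p - 1 := by linarith
  have hpq : 0 < p - 1 - q := by linarith
  have hg : 0 ≤ 1 / (p - 1) := by positivity
  set K : ℝ≥0∞ :=
    (1 + 2 ^ (q / (p - 1)) * (1 - 2 ^ (q / (p - 1) - 1))⁻¹ * N) ^ ((p - 1) / (p - 1 - q)) with hK
  have hKt : K ≠ ⊤ := by
    apply ENNReal.rpow_ne_top_of_nonneg (by positivity)
    have h1 : (2 : ℝ≥0∞) ^ (q / (p - 1) - 1) < 1 := by
      apply ENNReal.rpow_lt_one_of_one_lt_of_neg (by norm_num)
      rw [sub_neg, div_lt_one hp1]; exact hq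
    refine ENNReal.add_ne_top.2 ⟨by simp, ENNReal.mul_ne_top (ENNReal.mul_ne_top ?_ ?_) (by simp)⟩
    · exact ENNReal.rpow_ne_top_of_nonneg (by positivity) (by simp)
    · exact ENNReal.inv_ne_top.2 (tsub_pos_of_lt h1).ne'
  set D : ℝ≥0∞ := ENNReal.ofReal (2 ^ ((n : ℝ) - α * p)) ^ (1 / (p - 1)) with hD
  have hDt : D ≠ ⊤ := ENNReal.rpow_ne_top_of_nonneg hg ENNReal.ofReal_ne_top
  have hKg : K ^ (1 / (p - 1)) ≠ ⊤ := ENNReal.rpow_ne_top_of_nonneg hg hKt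
  have hct : (K ^ (1 / (p - 1)) * D) ^ q ≠ ⊤ :=
    ENNReal.rpow_ne_top_of_nonneg hq0.le (ENNReal.mul_ne_top hKg hDt)
  refine ⟨(K ^ (1 / (p - 1)) * D) ^ q + 1, by simp, ENNReal.add_ne_top.2 ⟨hct, ENNReal.one_ne_top⟩, ?_⟩
  intro σ _ u hu hfin hnt hsup x t ht
  set ω := σ.withDensity fun y => u y ^ q with hω
  have hω0 : ω ≠ 0 := by
    intro h
    have : ω Set.univ = 0 := by simp [h]
    rw [hω, withDensity_apply _ MeasurableSet.univ, Measure.restrict_univ] at this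
    exact hnt.ne' this
  have hpos : ∀ᵐ x ∂σ, u x ≠ 0 := by
    filter_upwards [hsup] with y hy h0
    rw [h0] at hy
    exact wolff_pos n p α hp ω hω0 y (le_antisymm hy bot_le)
  have hkt : kappaTail n p α q σ x t ≤ K ^ (1 / (p - 1)) * wolffTail n p α ω x t := by
    unfold kappaTail wolffTail
    rw [← lintegral_const_mul' _ _ hKg]
    refine setLIntegral_mono' measurableSet_Ioi fun s hs => ?_
    have hs0 : 0 < s := ht.trans hs
    rw [← mul_div_assoc, ← ENNReal.mul_rpow_of_nonneg _ _ hg, ← mul_div_assoc]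
    gcongr
    refine kappa_bound n p q α hp hq0 hq hτ hN σ u hu hpos hsup _ measurableSet_ball ?_
    rw [withDensity_apply _ measurableSet_ball]
    exact hfin x s hs0
  calc σ (Metric.ball x t) * kappaTail n p α q σ x t ^ q
      = ∫⁻ _ in Metric.ball x t, kappaTail n p α q σ x t ^ q ∂σ := by
        rw [setLIntegral_const, mul_comm]
    _ ≤ ∫⁻ y in Metric.ball x t, (K ^ (1 / (p - 1)) * D) ^ q * u y ^ q ∂σ := by
        refine setLIntegral_mono_ae' measurableSet_ball ?_
        filter_upwards [hsup] with y hy hyB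
        rw [← ENNReal.mul_rpow_of_nonneg _ _ hq0.le]
        gcongr
        refine hkt.trans ?_
        rw [mul_assoc]
        gcongr
        exact (tail_le n p α hp ω x y t ht hyB).trans (by gcongr)
    _ = (K ^ (1 / (p - 1)) * D) ^ q * ∫⁻ y in Metric.ball x t, u y ^ q ∂σ :=
        lintegral_const_mul' _ _ hct
    _ ≤ _ := by gcongr; exact le_self_add
end

section
/- Let $1<p<\infty$, $0<q<p-1$, $0<\alpha<n/p$. Suppose $\sigma$ is a nonnegative locally finite Borel measure on $\mathbb{R}^n$ with $\int_1^\infty(\sigma(B(0,r))/r^{n-\alpha p})^{1/(p-1)}\,dr/r<\infty$ and $\int_1^\infty(\kappa(B(0,s))^{q(p-1)/(p-1-q)}/s^{n-\alpha p})^{1/(p-1)}\,ds/s<\infty$. Then there exists a solution $u\in L^q_{loc}(d\sigma)$ of $u=\mathbf{W}_{\alpha,p}(u^q\,d\sigma)$ and a constant $C=C(n,p,q,\alpha)>0$ such that $C^{-1}\big[\mathbf{K}_{\alpha,p}\sigma+(\mathbf{W}_{\alpha,p}\sigma)^{(p-1)/(p-1-q)}\big]\le u\le C\big[\mathbf{K}_{\alpha,p}\sigma+(\mathbf{W}_{\alpha,p}\sigma)^{(p-1)/(p-1-q)}\big]$,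 where $\mathbf{K}_{\alpha,p}\sigma(x)=\int_0^\infty(\kappa(B(x,s))^{q(p-1)/(p-1-q)}/s^{n-\alpha p})^{1/(p-1)}\,ds/s$. -/
open MeasureTheory ENNReal

/-- The intrinsic nonlinear potential of Wolff type. -/
noncomputable def Kpot (n : ℕ) (p α q : ℝ) (σ : Measure (EuclideanSpace ℝ (Fin n)))
    (x : EuclideanSpace ℝ (Fin n)) : ℝ≥0∞ :=
  kappaTail n p α q σ x 0

namespace WolffAux

noncomputable def wt (a d : ℝ) (s : ℝ) : ℝ≥0∞ :=
  (ENNReal.ofReal (s ^ d))⁻¹ ^ a * (ENNReal.ofReal s)⁻¹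

lemma wt_eq {a d s : ℝ} (hs : 0 < s) : wt a d s = ENNReal.ofReal (s ^ (-(d * a) - 1)) := by
  have h1 : 0 < s ^ d := Real.rpow_pos_of_pos hs d
  unfold wt
  rw [← ENNReal.ofReal_inv_of_pos h1, ← ENNReal.ofReal_inv_of_pos hs,
    ENNReal.ofReal_rpow_of_pos (inv_pos.2 h1), ← ENNReal.ofReal_mul (by positivity)]
  congr 1
  rw [Real.rpow_sub hs, Real.rpow_neg hs.le, Real.rpow_one, Real.inv_rpow h1.le,
    ← Real.rpow_mul hs.le]
  rfl

lemma measurable_wt (a d : ℝ) : Measurable (wt a d) := by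
  unfold wt
  fun_prop

noncomputable def II (a d : ℝ) (φ : ℝ → ℝ≥0∞) (R : ℝ) : ℝ≥0∞ :=
  ∫⁻ s in Set.Ioi R, φ s ^ a * wt a d s

lemma div_rpow_div_eq {a d s : ℝ} (ha : 0 ≤ a) (x : ℝ≥0∞) :
    (x / ENNReal.ofReal (s ^ d)) ^ a / ENNReal.ofReal s = x ^ a * wt a d s := by
  rw [div_eq_mul_inv, div_eq_mul_inv, ENNReal.mul_rpow_of_nonneg _ _ ha, mul_assoc]
  rfl

lemma lintegral_Ioi_mul_left (g : ℝ → ℝ≥0∞) {c : ℝ} (hc : 0 < c) (R : ℝ) :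
    ∫⁻ s in Set.Ioi (c * R), g s = ENNReal.ofReal c * ∫⁻ s in Set.Ioi R, g (c * s) := by
  rw [← lintegral_indicator measurableSet_Ioi, ← lintegral_indicator measurableSet_Ioi]
  conv_lhs => rw [← Real.smul_map_volume_mul_left hc.ne']
  rw [lintegral_smul_measure, abs_of_pos hc]
  have := lintegral_map_equiv (μ := volume) ((Set.Ioi (c * R)).indicator g)
    (MeasurableEquiv.mulLeft₀ c hc.ne')
  simp only [MeasurableEquiv.coe_mulLeft₀] at this
  rw [this, smul_eq_mul]
  congr 2
  ext s
  simp only [Set.indicator, Set.mem_Ioi, mul_lt_mul_iff_right₀ hc]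

lemma wt_scale {a d c s : ℝ} (hc : 0 < c) (hs : 0 < s) :
    wt a d s = ENNReal.ofReal (c ^ (d * a)) * ENNReal.ofReal c * wt a d (c * s) := by
  rw [wt_eq hs, wt_eq (mul_pos hc hs), ← ENNReal.ofReal_mul (by positivity),
    ← ENNReal.ofReal_mul (by positivity)]
  congr 1
  rw [Real.mul_rpow hc.le hs.le, ← mul_assoc]
  have : c ^ (d * a) * c * c ^ (-(d * a) - 1) = 1 := by
    nth_rewrite 2 [← Real.rpow_one c]
    rw [← Real.rpow_add hc, ← Real.rpow_add hc]
    ring_nf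
    simp
  rw [this, one_mul]

lemma II_scale {a d c R : ℝ} (φ : ℝ → ℝ≥0∞) (hc : 0 < c) (hR : 0 ≤ R) :
    II a d (fun s => φ (c * s)) R = ENNReal.ofReal (c ^ (d * a)) * II a d φ (c * R) := by
  unfold II
  rw [lintegral_Ioi_mul_left _ hc, ← mul_assoc,
    ← lintegral_const_mul' _ _ (by finiteness)]
  refine setLIntegral_congr_fun measurableSet_Ioi fun s hs => ?_
  have hs' : 0 < s := lt_of_le_of_lt hR hs
  rw [wt_scale hc hs']
  ring

lemma II_mono {a d R : ℝ} (ha : 0 ≤ a) {φ ψ : ℝ → ℝ≥0∞} (h : ∀ s, R < s → φ s ≤ ψ s) :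
    II a d φ R ≤ II a d ψ R := by
  unfold II
  refine setLIntegral_mono' measurableSet_Ioi fun s hs => ?_
  gcongr
  exact h s hs

lemma II_anti {a d R R' : ℝ} {φ : ℝ → ℝ≥0∞} (h : R ≤ R') : II a d φ R' ≤ II a d φ R :=
  lintegral_mono_set (Set.Ioi_subset_Ioi h)

lemma II_const_mul {a d R : ℝ} (ha : 0 ≤ a) (c : ℝ≥0∞) (hc : c ≠ ∞) (φ : ℝ → ℝ≥0∞) :
    II a d (fun s => c * φ s) R = c ^ a * II a d φ R := by
  unfold II
  rw [← lintegral_const_mul' _ _ (by finiteness)]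
  refine lintegral_congr fun s => ?_
  rw [ENNReal.mul_rpow_of_nonneg _ _ ha, mul_assoc]

lemma iSup_rpow {ι : Type*} (f : ι → ℝ≥0∞) {a : ℝ} (ha : 0 < a) :
    (⨆ i, f i) ^ a = ⨆ i, f i ^ a :=
  (ENNReal.orderIsoRpow a ha).map_iSup f

lemma II_iSup {a d R : ℝ} (ha : 0 < a) (φ : ℕ → ℝ → ℝ≥0∞) (hm : ∀ k, Measurable (φ k))
    (hmono : Monotone φ) :
    II a d (fun s => ⨆ k, φ k s) R = ⨆ k, II a d (φ k) R := by
  unfold II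
  rw [← lintegral_iSup]
  · refine lintegral_congr fun s => ?_
    rw [iSup_rpow _ ha, ENNReal.iSup_mul]
  · intro k
    exact ((hm k).pow_const a).mul (measurable_wt a d)
  · intro i j hij s
    dsimp only
    gcongr
    exact hmono hij s

lemma add_rpow_le (x y : ℝ≥0∞) {r : ℝ} (hr : 0 ≤ r) :
    (x + y) ^ r ≤ 2 ^ r * (x ^ r + y ^ r) := by
  have h : x + y ≤ 2 * max x y := by
    rw [two_mul]; exact add_le_add (le_max_left _ _) (le_max_right _ _)
  calc (x + y) ^ r ≤ (2 * max x y) ^ r := ENNReal.rpow_le_rpow h hr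
    _ = 2 ^ r * (max x y) ^ r := ENNReal.mul_rpow_of_nonneg _ _ hr
    _ ≤ _ := by
      gcongr
      rcases le_total x y with h | h
      · rw [max_eq_right h]; exact le_add_self
      · rw [max_eq_left h]; exact le_self_add

lemma II_add {a d R : ℝ} (ha : 0 ≤ a) (φ ψ : ℝ → ℝ≥0∞) (hφ : Measurable φ) :
    II a d (fun s => φ s + ψ s) R ≤ 2 ^ a * (II a d φ R + II a d ψ R) := by
  unfold II
  have hm : Measurable fun s => φ s ^ a * wt a d s := (hφ.pow_const a).mul (measurable_wt a d)
  rw [← lintegral_add_left hm, ← lintegral_const_mul' _ _ (by finiteness)]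
  refine lintegral_mono fun s => ?_
  rw [← add_mul, ← mul_assoc]
  gcongr
  exact add_rpow_le _ _ ha

lemma II_split {a d R : ℝ} (hR : 0 ≤ R) (φ : ℝ → ℝ≥0∞) :
    II a d φ 0 = (∫⁻ s in Set.Ioc 0 R, φ s ^ a * wt a d s) + II a d φ R := by
  unfold II
  rw [← lintegral_union measurableSet_Ioi (Set.Ioc_disjoint_Ioi le_rfl),
    Set.Ioc_union_Ioi_eq_Ioi hR]

lemma II_const_ne_top {a d R : ℝ} (ha : 0 < a) (hd : 0 < d) (hR : 0 < R) (c : ℝ≥0∞) (hc : c ≠ ∞) :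
    II a d (fun _ => c) R ≠ ∞ := by
  unfold II
  rw [lintegral_const_mul' _ _ (by finiteness)]
  refine ENNReal.mul_ne_top (by finiteness) ?_
  have h : IntegrableOn (fun s : ℝ => s ^ (-(d * a) - 1)) (Set.Ioi R) :=
    integrableOn_Ioi_rpow_of_lt (by nlinarith [mul_pos hd ha]) hR
  have := h.lintegral_lt_top
  refine ne_of_lt (lt_of_le_of_lt (le_of_eq ?_) this)
  refine setLIntegral_congr_fun measurableSet_Ioi fun s hs => ?_
  exact wt_eq (hR.trans hs)

/-- A discrete version of the fundamental theorem of calculus. -/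
lemma lintegral_tail_rpow (f : ℝ → ℝ≥0∞) (hf : Measurable f) {β : ℝ} (hβ : 0 ≤ β)
    (hfin : ∀ s, 0 < s → ∫⁻ t in Set.Ioi s, f t ≠ ∞) :
    (2⁻¹) ^ (β + 1) * (∫⁻ t in Set.Ioi 0, f t) ^ (β + 1)
      ≤ ∫⁻ s in Set.Ioi 0, (∫⁻ t in Set.Ioi s, f t) ^ β * f s := by
  set F : ℝ → ℝ≥0∞ := fun s => ∫⁻ t in Set.Ioi s, f t with hF
  have hanti : Antitone F := fun s t hst => lintegral_mono_set (Set.Ioi_subset_Ioi hst)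
  change (2⁻¹) ^ (β + 1) * (F 0) ^ (β + 1) ≤ ∫⁻ s in Set.Ioi 0, F s ^ β * f s
  -- right continuity
  have hright : ∀ (s : ℝ) (M : ℝ≥0∞), (∀ t, s < t → F t ≤ M) → F s ≤ M := by
    intro s M h
    have hU : Set.Ioi s = ⋃ k : ℕ, Set.Ioi (s + 1 / ((k : ℝ) + 1)) := by
      ext t
      simp only [Set.mem_Ioi, Set.mem_iUnion]
      constructor
      · intro ht
        obtain ⟨k, hk⟩ := exists_nat_one_div_lt (sub_pos.2 ht)
        exact ⟨k, by linarith⟩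
      · rintro ⟨k, hk⟩
        have : (0 : ℝ) < 1 / ((k : ℝ) + 1) := by positivity
        linarith
    have hmono : Monotone fun k : ℕ => Set.Ioi (s + 1 / ((k : ℝ) + 1)) := by
      intro i j hij
      apply Set.Ioi_subset_Ioi
      gcongr
    have : F s = ⨆ k : ℕ, F (s + 1 / ((k : ℝ) + 1)) := by
      have h2 := hmono.measure_iUnion (μ := volume.withDensity f)
      rw [← hU, withDensity_apply _ measurableSet_Ioi] at h2
      rw [hF]; dsimp only
      rw [h2]
      congr 1
      ext k
      rw [withDensity_apply _ measurableSet_Ioi]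
    rw [this]
    refine iSup_le fun k => h _ ?_
    have : (0 : ℝ) < 1 / ((k : ℝ) + 1) := by positivity
    linarith
  have key : ∀ (s : ℝ) (M : ℝ≥0∞), 0 ≤ s → (∀ t, t < s → M ≤ F t) →
      M ^ β * (∫⁻ t in Set.Ioc 0 s, f t) ≤ ∫⁻ s in Set.Ioi 0, F s ^ β * f s := by
    intro s M hs hM
    rw [← lintegral_const_mul _ hf]
    calc ∫⁻ t in Set.Ioc 0 s, M ^ β * f t = ∫⁻ t in Set.Ioo 0 s, M ^ β * f t :=
          setLIntegral_congr Ioo_ae_eq_Ioc.symm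
      _ ≤ ∫⁻ t in Set.Ioo 0 s, F t ^ β * f t := by
          refine setLIntegral_mono' measurableSet_Ioo fun t ht => ?_
          gcongr
          exact hM t ht.2
      _ ≤ _ := lintegral_mono_set Set.Ioo_subset_Ioi_self
  have hsplit : ∀ s : ℝ, 0 ≤ s → F 0 = (∫⁻ t in Set.Ioc 0 s, f t) + F s := by
    intro s hs
    rw [hF]; dsimp only
    rw [← lintegral_union measurableSet_Ioi (Set.Ioc_disjoint_Ioi le_rfl),
      Set.Ioc_union_Ioi_eq_Ioi hs]
  by_cases h0 : F 0 = 0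
  · rw [h0, ENNReal.zero_rpow_of_pos (by linarith)]; simp
  by_cases htop : F 0 = ∞
  · -- infinite case
    have : ∃ s, 0 < s ∧ F s ≠ 0 := by
      by_contra! hcon
      exact h0 (le_antisymm (hright 0 0 fun t ht => (hcon t ht).le) bot_le)
    obtain ⟨s, hs, hFs⟩ := this
    have h1 : ∫⁻ t in Set.Ioc 0 s, f t = ∞ := by
      have := hsplit s hs.le
      rw [htop] at this
      by_contra hne
      exact ENNReal.add_ne_top.2 ⟨hne, hfin s hs⟩ this.symm
    have h2 := key s (F s) hs.le fun t ht => hanti ht.le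
    rw [h1, ENNReal.mul_top] at h2
    · exact le_top.trans h2
    · intro h
      rw [ENNReal.rpow_eq_zero_iff] at h
      rcases h with h | h
      · exact hFs h.1
      · exact hfin s hs h.1
  · have hgoal : ∀ X : ℝ≥0∞, 2⁻¹ * F 0 ≤ X → (2⁻¹) ^ (β + 1) * (F 0) ^ (β + 1) ≤
        (2⁻¹ * F 0) ^ β * X := by
      intro X hX
      rw [← ENNReal.mul_rpow_of_nonneg _ _ (by linarith), ENNReal.rpow_add_of_nonneg _ _ hβ zero_le_one,
        ENNReal.rpow_one]
      gcongr
    by_cases hne : ∃ s, 0 ≤ s ∧ F s ≤ 2⁻¹ * F 0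
    · set S : Set ℝ := {s | 0 ≤ s ∧ F s ≤ 2⁻¹ * F 0} with hS
      have hbdd : BddBelow S := ⟨0, fun s hs => hs.1⟩
      have hnon : S.Nonempty := hne
      set s0 := sInf S
      have hs0 : 0 ≤ s0 := le_csInf hnon fun s hs => hs.1
      have hup : F s0 ≤ 2⁻¹ * F 0 := by
        refine hright _ _ fun t ht => ?_
        obtain ⟨s, hs, hst⟩ := exists_lt_of_csInf_lt hnon ht
        exact (hanti hst.le).trans hs.2
      have hlow : ∀ t, t < s0 → 2⁻¹ * F 0 ≤ F t := by
        intro t ht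
        by_contra! hcon
        rcases lt_or_ge t 0 with h | h
        · refine absurd (hanti h.le) (not_le.2 (lt_of_lt_of_le hcon ?_))
          calc 2⁻¹ * F 0 ≤ 1 * F 0 := by gcongr; simp
            _ = F 0 := one_mul _
        · exact absurd (csInf_le hbdd (show t ∈ S from ⟨h, hcon.le⟩)) (not_le.2 ht)
      refine le_trans (hgoal _ ?_) (key s0 _ hs0 hlow)
      have h1 := hsplit s0 hs0
      have h2 : 2⁻¹ * F 0 + 2⁻¹ * F 0 = F 0 := by
        rw [← add_mul, ENNReal.inv_two_add_inv_two, one_mul]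
      have h3 : 2⁻¹ * F 0 + 2⁻¹ * F 0 ≤ (∫⁻ t in Set.Ioc 0 s0, f t) + 2⁻¹ * F 0 := by
        rw [h2]; nth_rewrite 1 [h1]; gcongr
      exact (ENNReal.add_le_add_iff_right (by finiteness)).1 h3
    · push Not at hne
      refine le_trans (hgoal (F 0) ?_) ?_
      · calc 2⁻¹ * F 0 ≤ 1 * F 0 := by gcongr; simp
            _ = F 0 := one_mul _
      · rw [hF]; dsimp only
        rw [← lintegral_const_mul _ hf]
        refine setLIntegral_mono' measurableSet_Ioi fun t ht => ?_
        gcongr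
        exact (hne t (le_of_lt ht)).le

end WolffAux


namespace WolffAux

set_option linter.unusedSectionVars false

variable {X : Type*} [MetricSpace X] [SecondCountableTopology X] [MeasurableSpace X] [BorelSpace X]

noncomputable def Wf (a d : ℝ) (τ : Measure X) (x : X) : ℝ≥0∞ :=
  II a d (fun s => τ (Metric.ball x s)) 0

lemma mono_ball (τ : Measure X) (x : X) : Monotone fun s => τ (Metric.ball x s) :=
  fun _ _ h => measure_mono (Metric.ball_subset_ball h)

lemma Wf_mono {a d : ℝ} (ha : 0 ≤ a) {τ τ' : Measure X} (h : τ ≤ τ') (x : X) :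
    Wf a d τ x ≤ Wf a d τ' x :=
  II_mono ha fun _ _ => h _

lemma measurable_Wf (a d : ℝ) (τ : Measure X) [SFinite τ] : Measurable (Wf a d τ) := by
  unfold Wf II
  have h1 : Measurable fun z : X × ℝ => τ (Metric.ball z.1 z.2) := by
    have hs : MeasurableSet {w : (X × ℝ) × X | dist w.2 w.1.1 < w.1.2} :=
      measurableSet_lt (by fun_prop) (by fun_prop)
    exact measurable_measure_prodMk_left hs
  have h2 : Measurable fun z : X × ℝ => τ (Metric.ball z.1 z.2) ^ a * wt a d z.2 :=
    (h1.pow_const a).mul ((measurable_wt a d).comp measurable_snd)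
  exact h2.lintegral_prod_right'

lemma eq_zero_of_Wf_eq_zero {a d : ℝ} (ha : 0 < a) (τ : Measure X) (x : X)
    (h : Wf a d τ x = 0) : τ = 0 := by
  unfold Wf II at h
  have hm : Measurable fun s => (fun s => τ (Metric.ball x s)) s ^ a * wt a d s :=
    ((mono_ball τ x).measurable.pow_const a).mul (measurable_wt a d)
  rw [lintegral_eq_zero_iff hm] at h
  rw [Filter.EventuallyEq, ae_restrict_iff' measurableSet_Ioi] at h
  have h2 : ∀ R : ℝ, 0 < R → τ (Metric.ball x R) = 0 := by
    intro R hR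
    by_contra hne
    have h3 : volume (Set.Ioi R) ≤ 0 := by
      rw [← ae_iff.1 h]
      refine measure_mono fun s hs => ?_
      simp only [Set.mem_ofPred_eq]
      intro hcon
      have hs0 : 0 < s := hR.trans hs
      have := hcon hs0
      simp only [Pi.zero_apply, mul_eq_zero] at this
      rcases this with h4 | h4
      · rw [ENNReal.rpow_eq_zero_iff_of_pos ha] at h4
        exact hne (le_antisymm (h4 ▸ mono_ball τ x (le_of_lt hs)) bot_le)
      · rw [wt_eq hs0, ENNReal.ofReal_eq_zero] at h4
        exact absurd (Real.rpow_pos_of_pos hs0 _) (not_lt.2 h4)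
    simp at h3
  rw [← Measure.measure_univ_eq_zero, ← Metric.iUnion_ball_nat x]
  refine measure_iUnion_null fun k => ?_
  refine le_antisymm ?_ bot_le
  rw [← h2 (k + 1) (by positivity)]
  exact mono_ball τ x (by linarith)

/-- Weak type estimate (Vitali). -/
lemma vitali_weak (ν ω : Measure X) (l : ℝ≥0∞) :
    l * ω {y | ∃ s : ℝ, 0 < s ∧ l * ω (Metric.ball y (6 * s)) < ν (Metric.ball y s)}
      ≤ ν Set.univ := by
  set E : ℕ → Set X := fun k => {y | ∃ s : ℝ, (0 < s ∧ s ≤ k) ∧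
    l * ω (Metric.ball y (6 * s)) < ν (Metric.ball y s)} with hE
  have hU : {y | ∃ s : ℝ, 0 < s ∧ l * ω (Metric.ball y (6 * s)) < ν (Metric.ball y s)}
      = ⋃ k, E k := by
    ext y
    simp only [Set.mem_ofPred_eq, Set.mem_iUnion, hE]
    constructor
    · rintro ⟨s, hs, h⟩
      obtain ⟨k, hk⟩ := exists_nat_ge s
      exact ⟨k, s, ⟨hs, hk⟩, h⟩
    · rintro ⟨k, s, hs, h⟩
      exact ⟨s, hs.1, h⟩
  have hmono : Monotone E := by
    rintro i j hij y ⟨s, hs, h⟩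
    exact ⟨s, ⟨hs.1, hs.2.trans (by exact_mod_cast hij)⟩, h⟩
  rw [hU, hmono.measure_iUnion, ENNReal.mul_iSup]
  refine iSup_le fun k => ?_
  have hch : ∀ y : E k, ∃ s : ℝ, (0 < s ∧ s ≤ k) ∧
    l * ω (Metric.ball (y : X) (6 * s)) < ν (Metric.ball (y : X) s) := fun y => y.2
  choose r hr hlt using hch
  obtain ⟨u, -, hdisj, hcov⟩ := Vitali.exists_disjoint_subfamily_covering_enlargement_closedBall
    (Set.univ : Set (E k)) (fun y => (y : X)) r k (fun y _ => (hr y).2) 5 (by norm_num)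
  have hdisj' : u.PairwiseDisjoint fun y => Metric.ball (y : X) (r y) :=
    hdisj.mono fun y => Metric.ball_subset_closedBall
  have hcount : u.Countable := hdisj'.countable_of_isOpen (fun _ _ => Metric.isOpen_ball)
    fun y _ => ⟨y, Metric.mem_ball_self (hr y).1⟩
  have hsub : E k ⊆ ⋃ y ∈ u, Metric.ball (y : X) (6 * r y) := by
    intro y hy
    obtain ⟨b, hb, hsubb⟩ := hcov ⟨y, hy⟩ (Set.mem_univ _)
    simp only [Set.mem_iUnion]
    refine ⟨b, hb, ?_⟩
    have h1 := hsubb (Metric.mem_closedBall_self (hr ⟨y, hy⟩).1.le)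
    refine Metric.closedBall_subset_ball ?_ h1
    have := (hr b).1
    linarith
  have : Countable u := hcount.to_subtype
  calc l * ω (E k) ≤ l * ∑' y : u, ω (Metric.ball (y : X) (6 * r y)) := by
        gcongr
        exact (measure_mono hsub).trans (measure_biUnion_le ω hcount _)
    _ = ∑' y : u, l * ω (Metric.ball (y : X) (6 * r y)) := ENNReal.tsum_mul_left.symm
    _ ≤ ∑' y : u, ν (Metric.ball (y : X) (r y)) := ENNReal.tsum_le_tsum fun y => (hlt y).le
    _ = ν (⋃ y ∈ u, Metric.ball (y : X) (r y)) :=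
        (measure_biUnion hcount hdisj' fun _ _ => measurableSet_ball).symm
    _ ≤ ν Set.univ := measure_mono (Set.subset_univ _)

/-- The Kolmogorov inequality. -/
lemma kolmogorov {θ : ℝ} (hθ0 : 0 < θ) (hθ1 : θ < 1) :
    ∃ C : ℝ≥0∞, C ≠ ∞ ∧ ∀ (ω : Measure X) (N : ℝ≥0∞) (h : X → ℝ≥0∞), N ≠ ∞ →
      IsFiniteMeasure ω → Measurable h →
      (∀ l : ℝ≥0∞, l ≠ ∞ → l * ω {y | l < h y} ≤ N) →
      ∫⁻ y, h y ^ θ ∂ω ≤ C * N ^ θ * ω Set.univ ^ (1 - θ) := by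
  set ρ : ℝ≥0∞ := 2 ^ (θ - 1) with hρ
  have hρ1 : ρ < 1 := by
    rw [hρ]
    exact ENNReal.rpow_lt_one_of_one_lt_of_neg (by norm_num) (by linarith)
  refine ⟨1 + 2 ^ θ * (1 - ρ)⁻¹, ?_, ?_⟩
  · have : (1 - ρ)⁻¹ ≠ ∞ := by
      rw [ENNReal.inv_ne_top]
      exact (tsub_pos_of_lt hρ1).ne'
    finiteness
  intro ω N h hN hω hh hweak
  by_cases hω0 : ω Set.univ = 0
  · rw [Measure.measure_univ_eq_zero] at hω0
    simp [hω0]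
  have hωt : ω Set.univ ≠ ∞ := measure_ne_top _ _
  by_cases hN0 : N = 0
  · have h0 : h =ᵐ[ω] 0 := by
      have hn : ∀ k : ℕ, ω {y | ((k : ℝ≥0∞) + 1)⁻¹ < h y} = 0 := by
        intro k
        have := hweak ((k : ℝ≥0∞) + 1)⁻¹ (by simp)
        rw [hN0] at this
        simpa [ENNReal.add_eq_top] using this
      have : ω (⋃ k : ℕ, {y | ((k : ℝ≥0∞) + 1)⁻¹ < h y}) = 0 := measure_iUnion_null hn
      refine measure_mono_null (fun y hy => ?_) this
      simp only [Set.mem_compl_iff, Set.mem_ofPred_eq, Pi.zero_apply] at hy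
      obtain ⟨k, hk⟩ := ENNReal.exists_inv_nat_lt hy
      simp only [Set.mem_iUnion, Set.mem_ofPred_eq]
      refine ⟨k, lt_of_le_of_lt ?_ hk⟩
      rw [ENNReal.inv_le_inv]
      exact le_self_add
    rw [lintegral_congr_ae (g := fun _ => 0)]
    · simp
    · filter_upwards [h0] with y hy
      simp only [Pi.zero_apply] at hy
      simp [hy, hθ0]
  -- main case
  set W := ω Set.univ with hW
  set l0 := N / W with hl0
  have hl0t : l0 ≠ ∞ := ENNReal.div_ne_top hN hω0
  have hl00 : l0 ≠ 0 := ENNReal.div_ne_zero.2 ⟨hN0, hωt⟩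
  have hlW : l0 * W = N := ENNReal.div_mul_cancel hω0 hωt
  have hpt : ∀ y, h y ^ θ ≤ l0 ^ θ + ∑' k : ℕ, Set.indicator {y | 2 ^ k * l0 < h y}
      (fun _ => (2 ^ (k + 1) * l0) ^ θ) y := by
    intro y
    by_cases hle : h y ≤ l0
    · exact (ENNReal.rpow_le_rpow hle hθ0.le).trans le_self_add
    push Not at hle
    by_cases hbig : ∀ k : ℕ, 2 ^ k * l0 < h y
    · have : ∑' k : ℕ, Set.indicator {y | 2 ^ k * l0 < h y}
          (fun _ => (2 ^ (k + 1) * l0) ^ θ) y = ∞ := by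
        refine le_antisymm le_top ?_
        calc ∞ = ∑' k : ℕ, l0 ^ θ := by
              rw [ENNReal.tsum_const_eq_top_of_ne_zero]
              rw [Ne, ENNReal.rpow_eq_zero_iff_of_pos hθ0]
              exact hl00
          _ ≤ _ := by
              refine ENNReal.tsum_le_tsum fun k => ?_
              rw [Set.indicator_of_mem (show y ∈ {y | 2 ^ k * l0 < h y} from hbig k)]
              refine ENNReal.rpow_le_rpow ?_ hθ0.le
              refine le_mul_of_one_le_left bot_le ?_
              exact one_le_pow₀ (by norm_num)
      rw [this]; simp
    · push Not at hbig
      classical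
      set k := Nat.find hbig with hk
      have hk1 : h y ≤ 2 ^ k * l0 := Nat.find_spec hbig
      have hk0 : k ≠ 0 := by
        intro hk0
        rw [hk0] at hk1
        simp only [pow_zero, one_mul] at hk1
        exact absurd hle (not_lt.2 hk1)
      obtain ⟨j, hj⟩ := Nat.exists_eq_succ_of_ne_zero hk0
      have hjlt : 2 ^ j * l0 < h y := by
        have := Nat.find_min hbig (m := j) (by omega)
        exact not_le.1 this
      refine le_trans ?_ le_add_self
      refine le_trans ?_ (ENNReal.le_tsum j)
      rw [Set.indicator_of_mem (show y ∈ {y | 2 ^ j * l0 < h y} from hjlt)]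
      refine ENNReal.rpow_le_rpow ?_ hθ0.le
      rw [hj] at hk1
      exact hk1
  have hterm : ∀ k : ℕ, (2 ^ (k + 1) * l0) ^ θ * ω {y | 2 ^ k * l0 < h y}
      ≤ 2 ^ θ * l0 ^ θ * W * ρ ^ k := by
    intro k
    have h1 := hweak (2 ^ k * l0) (by finiteness)
    have h2 : 2 ^ k * ω {y | 2 ^ k * l0 < h y} ≤ W := by
      rw [← hlW, mul_comm (2 ^ k) l0, mul_assoc] at h1
      rw [mul_comm l0 (2 ^ k)] at h1
      exact (ENNReal.mul_le_mul_iff_right hl00 hl0t).1 h1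
    have h3 : (2 ^ (k + 1) * l0 : ℝ≥0∞) ^ θ = 2 ^ θ * l0 ^ θ * ρ ^ k * 2 ^ k := by
      rw [ENNReal.mul_rpow_of_nonneg _ _ hθ0.le, hρ, pow_succ,
        ENNReal.mul_rpow_of_nonneg _ _ hθ0.le]
      have : ((2 : ℝ≥0∞) ^ k) ^ θ = ((2 : ℝ≥0∞) ^ (θ - 1)) ^ k * 2 ^ k := by
        rw [← ENNReal.rpow_natCast, ← ENNReal.rpow_natCast, ← ENNReal.rpow_mul,
          ← ENNReal.rpow_mul, ← ENNReal.rpow_add _ _ (by norm_num) (by norm_num)]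
        congr 1; ring
      rw [this]; ring
    rw [h3]
    calc 2 ^ θ * l0 ^ θ * ρ ^ k * 2 ^ k * ω {y | 2 ^ k * l0 < h y}
        = 2 ^ θ * l0 ^ θ * ρ ^ k * (2 ^ k * ω {y | 2 ^ k * l0 < h y}) := by ring
      _ ≤ 2 ^ θ * l0 ^ θ * ρ ^ k * W := by gcongr
      _ = _ := by ring
  have hmeas : ∀ k : ℕ, MeasurableSet {y | 2 ^ k * l0 < h y} :=
    fun k => measurableSet_lt measurable_const hh
  calc ∫⁻ y, h y ^ θ ∂ω ≤ ∫⁻ y, (l0 ^ θ + ∑' k : ℕ, Set.indicator {y | 2 ^ k * l0 < h y}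
      (fun _ => (2 ^ (k + 1) * l0) ^ θ) y) ∂ω := lintegral_mono hpt
    _ = l0 ^ θ * W + ∑' k : ℕ, (2 ^ (k + 1) * l0) ^ θ * ω {y | 2 ^ k * l0 < h y} := by
      rw [lintegral_add_left measurable_const, lintegral_const, lintegral_tsum]
      · congr 2
        ext k
        rw [lintegral_indicator_const (hmeas k)]
      · intro k
        exact (measurable_const.indicator (hmeas k)).aemeasurable
    _ ≤ l0 ^ θ * W + ∑' k : ℕ, 2 ^ θ * l0 ^ θ * W * ρ ^ k := by
      exact add_le_add le_rfl (ENNReal.tsum_le_tsum hterm)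
    _ = (1 + 2 ^ θ * (1 - ρ)⁻¹) * (l0 ^ θ * W) := by
      rw [ENNReal.tsum_mul_left, ENNReal.tsum_geometric]; ring
    _ = _ := by
      rw [mul_assoc]
      congr 1
      rw [← hlW, ENNReal.mul_rpow_of_nonneg _ _ hθ0.le, mul_assoc,
        ← ENNReal.rpow_add _ _ hω0 hωt]
      simp

end WolffAux


namespace WolffAux

set_option linter.unusedSectionVars false

variable {X : Type*} [MetricSpace X] [SecondCountableTopology X] [MeasurableSpace X] [BorelSpace X]

noncomputable def kap (a d q : ℝ) (σ : Measure X) (A : Set X) : ℝ≥0∞ :=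
  sInf {κ : ℝ≥0∞ | ∀ ν : Measure X, IsFiniteMeasure ν →
    (∫⁻ x in A, Wf a d ν x ^ q ∂σ) ^ (1 / q) ≤ κ * (ν Set.univ) ^ a}

lemma kap_mono {a d q : ℝ} (hq : 0 < q) (σ : Measure X) {A B : Set X} (h : A ⊆ B) :
    kap a d q σ A ≤ kap a d q σ B := by
  refine sInf_le_sInf fun κ hκ ν hν => le_trans ?_ (hκ ν hν)
  refine ENNReal.rpow_le_rpow (lintegral_mono_set h) (by positivity)

lemma kap_ineq {a d q : ℝ} (ha : 0 < a) (hq : 0 < q) (σ : Measure X) {A : Set X}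
    (hA : kap a d q σ A ≠ ∞) (ν : Measure X) [IsFiniteMeasure ν] :
    ∫⁻ x in A, Wf a d ν x ^ q ∂σ ≤ kap a d q σ A ^ q * (ν Set.univ) ^ (q * a) := by
  have hne : ∃ κ : ℝ≥0∞, ∀ ν : Measure X, IsFiniteMeasure ν →
    (∫⁻ x in A, Wf a d ν x ^ q ∂σ) ^ (1 / q) ≤ κ * (ν Set.univ) ^ a := by
    by_contra! hcon
    apply hA
    unfold kap
    rw [sInf_eq_top]
    intro κ hκ
    obtain ⟨ν, hν, hlt⟩ := hcon κ
    exact absurd (hκ ν hν) (not_le.2 hlt)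
  obtain ⟨κ0, hκ0⟩ := hne
  have key : (∫⁻ x in A, Wf a d ν x ^ q ∂σ) ^ (1 / q) ≤ kap a d q σ A * (ν Set.univ) ^ a := by
    by_cases h0 : ν Set.univ = 0
    · have := hκ0 ν inferInstance
      rw [h0, ENNReal.zero_rpow_of_pos ha, mul_zero] at this ⊢
      exact this
    · have h1 : (ν Set.univ) ^ a ≠ 0 := by
        rw [Ne, ENNReal.rpow_eq_zero_iff_of_pos ha]; exact h0
      have h2 : (ν Set.univ) ^ a ≠ ∞ := by finiteness
      rw [← ENNReal.div_le_iff h1 h2]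
      refine le_sInf fun κ hκ => ?_
      rw [ENNReal.div_le_iff h1 h2]
      exact hκ ν inferInstance
  have := ENNReal.rpow_le_rpow key hq.le
  rw [← ENNReal.rpow_mul, one_div_mul_cancel hq.ne', ENNReal.rpow_one,
    ENNReal.mul_rpow_of_nonneg _ _ hq.le, ← ENNReal.rpow_mul, mul_comm a q] at this
  exact this

lemma kap_le {a d q g : ℝ} (ha : 0 < a) (hq : 0 < q) (hqa : q * a < 1)
    (hg : g * (1 - q * a) = 1) :
    ∃ C : ℝ≥0∞, C ≠ 0 ∧ C ≠ ∞ ∧ ∀ (σ : Measure X) (A : Set X) (u : X → ℝ≥0∞), SFinite σ →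
      MeasurableSet A → Measurable u → (∀ᵐ y ∂(σ.restrict A), u y ≠ 0 ∧ u y ≠ ∞) →
      (∀ y, Wf a d ((σ.restrict A).withDensity fun y => u y ^ q) y ≤ u y) →
      kap a d q σ A ^ (q * g) ≤ C * ∫⁻ y in A, u y ^ q ∂σ := by
  have hg0 : 0 < g := by
    by_contra! h
    nlinarith
  obtain ⟨C, hC, hK⟩ := kolmogorov (X := X) (θ := q * a) (by positivity) hqa
  set c : ℝ≥0∞ := ENNReal.ofReal (6 ^ (d * a)) with hc
  have hct : c ≠ ∞ := by finiteness
  have hc0 : c ≠ 0 := by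
    rw [hc, Ne, ENNReal.ofReal_eq_zero, not_le]
    positivity
  refine ⟨(c ^ q * C) ^ g + 1, by simp, by finiteness, ?_⟩
  intro σ A u hσ hA hu hpos hsup
  by_cases hI : ∫⁻ y in A, u y ^ q ∂σ = ∞
  · rw [hI, ENNReal.mul_top (by simp)]; exact le_top
  set ω : Measure X := (σ.restrict A).withDensity fun y => u y ^ q with hω
  have huq : Measurable fun y => u y ^ q := hu.pow_const q
  have hωu : ω Set.univ = ∫⁻ y in A, u y ^ q ∂σ := by
    rw [hω, withDensity_apply _ MeasurableSet.univ, Measure.restrict_univ]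
  have hωfin : IsFiniteMeasure ω := ⟨by rw [hωu]; exact lt_top_iff_ne_top.2 hI⟩
  have hmain : kap a d q σ A ≤ (c ^ q * C * ω Set.univ ^ (1 - q * a)) ^ (1 / q) := by
    refine sInf_le ?_
    intro ν hν
    set h : X → ℝ≥0∞ := fun y => (Wf a d ν y / (c * u y)) ^ (1 / a) with hh
    have hhm : Measurable h :=
      ((measurable_Wf a d ν).div (hu.const_mul c)).pow_const _
    have hweak : ∀ l : ℝ≥0∞, l ≠ ∞ → l * ω {y | l < h y} ≤ ν Set.univ := by
      intro l hl
      refine le_trans ?_ (vitali_weak ν ω l)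
      refine mul_le_mul' le_rfl (measure_mono ?_)
      intro y hy
      change l < h y at hy
      change ∃ s : ℝ, 0 < s ∧ l * ω (Metric.ball y (6 * s)) < ν (Metric.ball y s)
      by_contra! hcon
      refine absurd hy (not_lt.2 ?_)
      have h1 : Wf a d ν y ≤ l ^ a * (c * u y) := by
        calc Wf a d ν y ≤ II a d (fun s => l * ω (Metric.ball y (6 * s))) 0 :=
              II_mono ha.le hcon
          _ = l ^ a * (c * Wf a d ω y) := by
              rw [II_const_mul ha.le _ hl,
                II_scale (fun s => ω (Metric.ball y s)) (by norm_num) le_rfl, mul_zero]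
              rfl
          _ ≤ _ := by gcongr; exact hsup y
      have h2 : Wf a d ν y / (c * u y) ≤ l ^ a := ENNReal.div_le_of_le_mul h1
      calc h y ≤ (l ^ a) ^ (1 / a) := ENNReal.rpow_le_rpow h2 (by positivity)
        _ = l := by rw [← ENNReal.rpow_mul, mul_one_div_cancel ha.ne', ENNReal.rpow_one]
    have h3 := hK ω (ν Set.univ) h (measure_ne_top _ _) hωfin hhm hweak
    have h4 : ∫⁻ x in A, Wf a d ν x ^ q ∂σ = c ^ q * ∫⁻ y, h y ^ (q * a) ∂ω := by
      rw [hω, lintegral_withDensity_eq_lintegral_mul _ huq (hhm.pow_const _),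
        ← lintegral_const_mul' _ _ (by finiteness)]
      refine lintegral_congr_ae ?_
      filter_upwards [hpos] with y hy
      simp only [Pi.mul_apply, hh]
      rw [← ENNReal.rpow_mul, show 1 / a * (q * a) = q by field_simp,
        ← ENNReal.mul_rpow_of_nonneg _ _ hq.le, ← ENNReal.mul_rpow_of_nonneg _ _ hq.le,
        ← mul_assoc, mul_comm, ENNReal.div_mul_cancel]
      · exact mul_ne_zero hc0 hy.1
      · exact ENNReal.mul_ne_top hct hy.2
    calc (∫⁻ x in A, Wf a d ν x ^ q ∂σ) ^ (1 / q)
        ≤ (c ^ q * C * ω Set.univ ^ (1 - q * a) * ν Set.univ ^ (q * a)) ^ (1 / q) := by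
          rw [h4]
          refine ENNReal.rpow_le_rpow ?_ (by positivity)
          calc c ^ q * ∫⁻ y, h y ^ (q * a) ∂ω
              ≤ c ^ q * (C * ν Set.univ ^ (q * a) * ω Set.univ ^ (1 - q * a)) := by gcongr
            _ = _ := by ring
      _ = _ := by
          rw [ENNReal.mul_rpow_of_nonneg _ _ (by positivity), ← ENNReal.rpow_mul (ν Set.univ)]
          congr 2
          field_simp
  calc kap a d q σ A ^ (q * g)
      ≤ ((c ^ q * C * ω Set.univ ^ (1 - q * a)) ^ (1 / q)) ^ (q * g) :=
        ENNReal.rpow_le_rpow hmain (by positivity)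
    _ = (c ^ q * C) ^ g * ω Set.univ := by
        rw [← ENNReal.rpow_mul, show 1 / q * (q * g) = g by field_simp,
          ENNReal.mul_rpow_of_nonneg _ _ hg0.le, ← ENNReal.rpow_mul, mul_comm (1 - q * a), hg,
          ENNReal.rpow_one]
    _ ≤ ((c ^ q * C) ^ g + 1) * ∫⁻ y in A, u y ^ q ∂σ := by
        rw [hωu]; gcongr; exact le_self_add

noncomputable def TT (a d q : ℝ) (σ : Measure X) (f : X → ℝ≥0∞) (x : X) : ℝ≥0∞ :=
  Wf a d (σ.withDensity fun y => f y ^ q) x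

lemma TT_mono {a d q : ℝ} (ha : 0 ≤ a) (hq : 0 ≤ q) (σ : Measure X) {f f' : X → ℝ≥0∞}
    (h : f ≤ f') : TT a d q σ f ≤ TT a d q σ f' := by
  intro x
  refine Wf_mono ha (withDensity_mono ?_) x
  exact Filter.Eventually.of_forall fun y => ENNReal.rpow_le_rpow (h y) hq

lemma measurable_TT (a d q : ℝ) (σ : Measure X) [SFinite σ] (f : X → ℝ≥0∞) :
    Measurable (TT a d q σ f) := measurable_Wf a d _

/-- Picard iterates. -/
noncomputable def UU (a d q : ℝ) (σ : Measure X) (z : X → ℝ≥0∞) (j : ℕ) : X → ℝ≥0∞ :=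
  (TT a d q σ)^[j] z

lemma UU_succ (a d q : ℝ) (σ : Measure X) (z : X → ℝ≥0∞) (j : ℕ) :
    UU a d q σ z (j + 1) = TT a d q σ (UU a d q σ z j) :=
  Function.iterate_succ_apply' _ _ _

lemma measurable_UU (a d q : ℝ) (σ : Measure X) [SFinite σ] {z : X → ℝ≥0∞} (hz : Measurable z)
    (j : ℕ) : Measurable (UU a d q σ z j) := by
  cases j with
  | zero => exact hz
  | succ j => rw [UU_succ]; exact measurable_TT _ _ _ _ _

lemma monotone_UU {a d q : ℝ} (ha : 0 ≤ a) (hq : 0 ≤ q) (σ : Measure X) {z : X → ℝ≥0∞}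
    (hz : z ≤ TT a d q σ z) : Monotone (UU a d q σ z) := by
  refine monotone_nat_of_le_succ fun j => ?_
  induction j with
  | zero => rw [UU_succ]; exact hz
  | succ j ih => rw [UU_succ, UU_succ a d q σ z (j + 1)]; exact TT_mono ha hq σ ih

lemma TT_iSup {a d q : ℝ} (ha : 0 < a) (hq : 0 < q) (σ : Measure X) (f : ℕ → X → ℝ≥0∞)
    (hm : ∀ j, Measurable (f j)) (hmono : Monotone f) (x : X) :
    TT a d q σ (fun y => ⨆ j, f j y) x = ⨆ j, TT a d q σ (f j) x := by
  unfold TT Wf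
  rw [← II_iSup ha]
  · congr 1
    ext s
    simp_rw [withDensity_apply _ measurableSet_ball, iSup_rpow _ hq]
    rw [lintegral_iSup]
    · exact fun j => (hm j).pow_const q
    · intro i j hij y
      exact ENNReal.rpow_le_rpow (hmono hij y) hq.le
  · exact fun j => (mono_ball _ x).measurable
  · intro i j hij s
    refine withDensity_mono ?_ _
    exact Filter.Eventually.of_forall fun y => ENNReal.rpow_le_rpow (hmono hij y) hq.le

noncomputable def fixU (a d q : ℝ) (σ : Measure X) (z : X → ℝ≥0∞) (x : X) : ℝ≥0∞ :=
  ⨆ j, UU a d q σ z j x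

lemma measurable_fixU (a d q : ℝ) (σ : Measure X) [SFinite σ] {z : X → ℝ≥0∞} (hz : Measurable z) :
    Measurable (fixU a d q σ z) := Measurable.iSup fun j => measurable_UU a d q σ hz j

lemma le_fixU (a d q : ℝ) (σ : Measure X) (z : X → ℝ≥0∞) (x : X) : z x ≤ fixU a d q σ z x :=
  le_iSup (fun j => UU a d q σ z j x) 0

lemma fixU_eq {a d q : ℝ} (ha : 0 < a) (hq : 0 < q) (σ : Measure X) [SFinite σ] {z : X → ℝ≥0∞}
    (hz : Measurable z) (hzT : z ≤ TT a d q σ z) (x : X) :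
    fixU a d q σ z x = TT a d q σ (fixU a d q σ z) x := by
  have hmono := monotone_UU ha.le hq.le σ hzT
  have h := TT_iSup (d := d) ha hq σ _ (measurable_UU a d q σ hz) hmono x
  change TT a d q σ (fixU a d q σ z) x = _ at h
  rw [h]
  unfold fixU
  apply le_antisymm
  · refine iSup_le fun j => le_iSup_of_le j ?_
    rw [← UU_succ]
    exact hmono (Nat.le_succ j) x
  · refine iSup_le fun j => le_iSup_of_le (j + 1) ?_
    rw [UU_succ]

end WolffAux


namespace WolffAux

set_option linter.unusedSectionVars false

variable {X : Type*} [MetricSpace X] [SecondCountableTopology X] [MeasurableSpace X] [BorelSpace X]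

lemma TT_eq (a d q : ℝ) (σ : Measure X) (f : X → ℝ≥0∞) (x : X) :
    TT a d q σ f x = II a d (fun s => ∫⁻ y in Metric.ball x s, f y ^ q ∂σ) 0 := by
  unfold TT Wf
  simp_rw [withDensity_apply _ measurableSet_ball]

lemma TT_mono_measure {a d q : ℝ} (ha : 0 ≤ a) {σ σ' : Measure X} (h : σ ≤ σ')
    (f : X → ℝ≥0∞) (x : X) : TT a d q σ f x ≤ TT a d q σ' f x := by
  rw [TT_eq, TT_eq]
  refine II_mono ha fun s _ => ?_
  exact lintegral_mono' (Measure.restrict_mono le_rfl h) le_rfl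

lemma TT_const_mul {a d q : ℝ} (ha : 0 < a) (hq : 0 < q) (σ : Measure X) (f : X → ℝ≥0∞)
    (c : ℝ≥0∞) (hc : c ≠ ∞) (x : X) :
    TT a d q σ (fun y => c * f y) x = c ^ (q * a) * TT a d q σ f x := by
  rw [TT_eq, TT_eq, ENNReal.rpow_mul, ← II_const_mul ha.le _ (by finiteness)]
  congr 1
  ext s
  rw [← lintegral_const_mul' _ _ (by finiteness)]
  refine lintegral_congr fun y => ?_
  rw [ENNReal.mul_rpow_of_nonneg _ _ hq.le]

/-- tails of potentials at nearby points -/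
lemma II_tail_le {a d s : ℝ} (ha : 0 ≤ a) (hs : 0 ≤ s) (Φ : Set X → ℝ≥0∞) (hΦ : Monotone Φ)
    {x y : X} (hxy : dist x y < s) :
    II a d (fun t => Φ (Metric.ball x t)) s
      ≤ ENNReal.ofReal (2 ^ (d * a)) * II a d (fun t => Φ (Metric.ball y t)) (2 * s) := by
  rw [← II_scale (fun t => Φ (Metric.ball y t)) two_pos hs]
  refine II_mono ha fun t ht => hΦ ?_
  refine Metric.ball_subset_ball' ?_
  linarith

lemma lower_raw {a d q g : ℝ} (ha : 0 < a) (hd : 0 < d) (hq : 0 < q) (hg0 : 0 < g)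
    (hg : g * (1 - q * a) = 1) :
    ∃ c : ℝ≥0∞, c ≠ 0 ∧ c ≠ ∞ ∧ ∀ (τ : Measure X), IsFiniteMeasure τ → ∀ x,
      c * Wf a d τ x ^ g ≤ TT a d q τ (fun y => Wf a d τ y ^ g) x := by
  set k : ℝ≥0∞ := ENNReal.ofReal (2 ^ (d * a)) with hk
  have hkt : k ≠ ∞ := by finiteness
  have hk0 : k ≠ 0 := by
    rw [hk, Ne, ENNReal.ofReal_eq_zero, not_le]
    positivity
  set β : ℝ := g * q * a with hβ
  have hβ1 : β + 1 = g := by rw [hβ]; linarith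
  have hβ0 : 0 < β := by positivity
  have hki0 : k⁻¹ ≠ 0 := ENNReal.inv_ne_zero.2 hkt
  have hkit : k⁻¹ ≠ ∞ := ENNReal.inv_ne_top.2 hk0
  refine ⟨k⁻¹ ^ β * 2⁻¹ ^ (β + 1), ?_, ?_, ?_⟩
  · refine mul_ne_zero ?_ ?_
    · rw [Ne, ENNReal.rpow_eq_zero_iff_of_pos hβ0]; exact hki0
    · rw [Ne, ENNReal.rpow_eq_zero_iff_of_pos (by linarith)]; simp
  · refine ENNReal.mul_ne_top (ENNReal.rpow_ne_top_of_nonneg hβ0.le hkit)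
      (ENNReal.rpow_ne_top_of_nonneg (by linarith) (by simp))
  intro τ hτ x
  set f : ℝ → ℝ≥0∞ := fun s => τ (Metric.ball x s) ^ a * wt a d s with hf
  have hfm : Measurable f := ((mono_ball τ x).measurable.pow_const a).mul (measurable_wt a d)
  have hfin : ∀ s, 0 < s → ∫⁻ t in Set.Ioi s, f t ≠ ∞ := by
    intro s hs
    refine ne_top_of_le_ne_top
      (II_const_ne_top ha hd hs (τ Set.univ) (measure_ne_top _ _)) ?_
    exact II_mono ha.le fun t _ => measure_mono (Set.subset_univ _)
  have h1 := lintegral_tail_rpow f hfm hβ0.le hfin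
  rw [TT_eq]
  calc k⁻¹ ^ β * 2⁻¹ ^ (β + 1) * Wf a d τ x ^ g
      = k⁻¹ ^ β * (2⁻¹ ^ (β + 1) * (∫⁻ t in Set.Ioi 0, f t) ^ (β + 1)) := by
        rw [mul_assoc, hβ1]; rfl
    _ ≤ k⁻¹ ^ β * ∫⁻ s in Set.Ioi 0, (∫⁻ t in Set.Ioi s, f t) ^ β * f s := by gcongr
    _ = ∫⁻ s in Set.Ioi 0, k⁻¹ ^ β * ((∫⁻ t in Set.Ioi s, f t) ^ β * f s) := by
        rw [lintegral_const_mul' _ _ (ENNReal.rpow_ne_top_of_nonneg hβ0.le hkit)]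
    _ ≤ _ := by
        refine setLIntegral_mono' measurableSet_Ioi fun s hs => ?_
        have hs0 : 0 < s := hs
        set Fs : ℝ≥0∞ := ∫⁻ t in Set.Ioi s, f t with hFs
        have h2 : ∀ y ∈ Metric.ball x s, k⁻¹ * Fs ≤ Wf a d τ y := by
          intro y hy
          have h3 : Fs ≤ k * Wf a d τ y := by
            refine (II_tail_le ha.le hs0.le (fun A => τ A) (fun _ _ h => measure_mono h)
              (x := x) (y := y) (by rw [dist_comm]; exact hy)).trans ?_
            gcongr
            exact II_anti (by linarith)
          calc k⁻¹ * Fs ≤ k⁻¹ * (k * Wf a d τ y) := by gcongr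
            _ = Wf a d τ y := by rw [← mul_assoc, ENNReal.inv_mul_cancel hk0 hkt, one_mul]
        have h4 : ((k⁻¹ * Fs) ^ g) ^ q * τ (Metric.ball x s)
            ≤ ∫⁻ y in Metric.ball x s, (Wf a d τ y ^ g) ^ q ∂τ := by
          rw [← setLIntegral_const]
          refine setLIntegral_mono' measurableSet_ball fun y hy => ?_
          gcongr
          exact h2 y hy
        calc k⁻¹ ^ β * (Fs ^ β * f s)
            = (((k⁻¹ * Fs) ^ g) ^ q * τ (Metric.ball x s)) ^ a * wt a d s := by
              rw [ENNReal.mul_rpow_of_nonneg _ _ ha.le, ← ENNReal.rpow_mul, ← ENNReal.rpow_mul,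
                ← mul_assoc g q a, ← hβ, ENNReal.mul_rpow_of_nonneg _ _ hβ0.le]
              ring
          _ ≤ _ := by gcongr

lemma lower_fin {a d q g : ℝ} (ha : 0 < a) (hd : 0 < d) (hq : 0 < q) (hg0 : 0 < g)
    (hg : g * (1 - q * a) = 1) :
    ∃ c : ℝ≥0∞, c ≠ 0 ∧ c ≠ ∞ ∧ ∀ (τ : Measure X), IsFiniteMeasure τ → ∀ x,
      c * Wf a d τ x ^ g ≤ TT a d q τ (fun y => c * Wf a d τ y ^ g) x := by
  obtain ⟨c, hc0, hct, h⟩ := lower_raw (X := X) ha hd hq hg0 hg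
  refine ⟨c ^ g, ?_, by finiteness, ?_⟩
  · rw [Ne, ENNReal.rpow_eq_zero_iff_of_pos hg0]; exact hc0
  intro τ hτ x
  rw [TT_const_mul ha hq _ _ _ (by finiteness)]
  calc c ^ g * Wf a d τ x ^ g = (c ^ g) ^ (q * a) * (c * Wf a d τ x ^ g) := by
        rw [← mul_assoc]
        congr 1
        nth_rewrite 3 [← ENNReal.rpow_one c]
        rw [← ENNReal.rpow_mul, ← ENNReal.rpow_add _ _ hc0 hct]
        congr 1; linarith
    _ ≤ _ := by gcongr; exact h τ hτ x

lemma Wf_restrict_iSup {a d : ℝ} (ha : 0 < a) (τ : Measure X) (E : ℕ → Set X)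
    (hE : Monotone E) (hEm : ∀ k, MeasurableSet (E k)) (h0 : τ (⋃ k, E k)ᶜ = 0) (x : X) :
    Wf a d τ x = ⨆ k, Wf a d (τ.restrict (E k)) x := by
  unfold Wf
  rw [← II_iSup ha]
  · congr 1
    ext s
    simp_rw [Measure.restrict_apply measurableSet_ball]
    have hm : Monotone fun k => Metric.ball x s ∩ E k :=
      fun i j hij => Set.inter_subset_inter_right _ (hE hij)
    rw [← hm.measure_iUnion, ← Set.inter_iUnion]
    refine (measure_inter_conull ?_).symm
    exact h0
  · exact fun j => (mono_ball _ x).measurable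
  · intro i j hij s
    exact Measure.restrict_mono (hE hij) le_rfl _

lemma const_mul_iSup_rpow {ι : Type*} (c : ℝ≥0∞) (f : ι → ℝ≥0∞) {g : ℝ} (hg : 0 < g) :
    c * (⨆ i, f i) ^ g = ⨆ i, c * f i ^ g := by
  rw [iSup_rpow _ hg, ENNReal.mul_iSup]

lemma lower_sfin {a d q g : ℝ} (ha : 0 < a) (hq : 0 < q) (hg0 : 0 < g)
    (c : ℝ≥0∞) (h : ∀ (τ : Measure X), IsFiniteMeasure τ → ∀ x,
      c * Wf a d τ x ^ g ≤ TT a d q τ (fun y => c * Wf a d τ y ^ g) x)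
    (σ : Measure X) [SigmaFinite σ] (x : X) :
    c * Wf a d σ x ^ g ≤ TT a d q σ (fun y => c * Wf a d σ y ^ g) x := by
  rw [Wf_restrict_iSup ha σ (spanningSets σ) (monotone_spanningSets σ)
    (fun k => measurableSet_spanningSets σ k) (by simp [iUnion_spanningSets]) x,
    const_mul_iSup_rpow _ _ hg0]
  refine iSup_le fun k => ?_
  have : IsFiniteMeasure (σ.restrict (spanningSets σ k)) :=
    ⟨by rw [Measure.restrict_apply_univ]; exact measure_spanningSets_lt_top σ k⟩
  refine (h _ this x).trans ?_
  refine (TT_mono_measure ha.le Measure.restrict_le_self _ x).trans ?_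
  refine TT_mono ha.le hq.le σ (fun y => ?_) x
  dsimp only
  gcongr
  exact Wf_mono ha.le Measure.restrict_le_self y

lemma arith_bound {a q g : ℝ} (hg0 : 0 < g) (hg : g * (1 - q * a) = 1)
    {A K : ℝ≥0∞} (hA : A ≠ ∞) (h : A ≤ K ^ q * A ^ (q * a)) : A ≤ K ^ (q * g) := by
  by_cases h0 : A = 0
  · rw [h0]; exact bot_le
  have h1 : A ^ (1 - q * a) ≤ K ^ q := by
    have h2 : A ^ (1 - q * a) * A ^ (q * a) ≤ K ^ q * A ^ (q * a) := by
      rw [← ENNReal.rpow_add _ _ h0 hA]; simpa using h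
    refine (ENNReal.mul_le_mul_iff_left ?_ ?_).1 h2
    · exact (ENNReal.rpow_pos (pos_iff_ne_zero.2 h0) hA).ne'
    · exact ENNReal.rpow_ne_top_of_ne_zero h0 hA
  calc A = (A ^ (1 - q * a)) ^ g := by
        rw [← ENNReal.rpow_mul, mul_comm, hg, ENNReal.rpow_one]
    _ ≤ (K ^ q) ^ g := ENNReal.rpow_le_rpow h1 hg0.le
    _ = _ := (ENNReal.rpow_mul _ _ _).symm

/-- The local solution. -/
lemma local_sol {a d q g : ℝ} (ha : 0 < a) (hq : 0 < q) (hg0 : 0 < g)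
    (hg : g * (1 - q * a) = 1)
    (c : ℝ≥0∞) (hct : c ≠ ∞) (h : ∀ (τ : Measure X), IsFiniteMeasure τ → ∀ x,
      c * Wf a d τ x ^ g ≤ TT a d q τ (fun y => c * Wf a d τ y ^ g) x)
    (σ : Measure X) (B : Set X) (hB : σ B ≠ ∞)
    (hk : kap a d q σ B ≠ ∞) :
    ∃ u : X → ℝ≥0∞, Measurable u ∧ (∀ y, u y = TT a d q (σ.restrict B) u y) ∧
      (∀ y, c * Wf a d (σ.restrict B) y ^ g ≤ u y) ∧
      ∫⁻ y in B, u y ^ q ∂σ ≤ kap a d q σ B ^ (q * g) := by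
  set τ := σ.restrict B with hτ
  have hτfin : IsFiniteMeasure τ :=
    ⟨by rw [hτ, Measure.restrict_apply_univ]; exact lt_top_iff_ne_top.2 hB⟩
  set K := kap a d q σ B with hK
  have hKt : ∀ r : ℝ, 0 ≤ r → K ^ r ≠ ∞ := fun r hr => ENNReal.rpow_ne_top_of_nonneg hr hk
  have hWm : Measurable (Wf a d τ) := measurable_Wf a d τ
  -- finiteness
  have hWfin : ∀ᵐ y ∂τ, Wf a d τ y < ∞ := by
    have h1 := kap_ineq ha hq σ hk τ
    have h2 : ∫⁻ x, Wf a d τ x ^ q ∂τ ≠ ∞ := by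
      refine ne_top_of_le_ne_top ?_ h1
      exact ENNReal.mul_ne_top (hKt q hq.le)
        (ENNReal.rpow_ne_top_of_nonneg (by positivity) (measure_ne_top _ _))
    filter_upwards [ae_lt_top (hWm.pow_const q) h2] with y hy
    exact (ENNReal.rpow_lt_top_iff_of_pos hq).1 hy
  set E : ℕ → Set X := fun k => {y | Wf a d τ y ≤ k} with hE
  have hEmono : Monotone E := fun i j hij y hy =>
    le_trans (show Wf a d τ y ≤ i from hy) (by exact_mod_cast hij)
  have hEm : ∀ k, MeasurableSet (E k) := fun k => measurableSet_le hWm measurable_const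
  have hE0 : τ (⋃ k, E k)ᶜ = 0 := by
    refine measure_mono_null (fun y hy => ?_) hWfin
    intro hlt
    apply hy
    obtain ⟨k, hk⟩ := ENNReal.exists_nat_gt (ne_of_lt hlt)
    exact Set.mem_iUnion.2 ⟨k, hk.le⟩
  set w : ℕ → X → ℝ≥0∞ := fun k y => c * Wf a d (τ.restrict (E k)) y ^ g with hw
  have hwm : ∀ k, Measurable (w k) := fun k =>
    ((measurable_Wf a d _).pow_const g).const_mul c
  have hwmono : Monotone w := by
    intro i j hij y
    simp only [hw]
    gcongr
    exact Wf_mono ha.le (Measure.restrict_mono (hEmono hij) le_rfl) y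
  set z : ℕ → X → ℝ≥0∞ := fun k => (E k).indicator (w k) with hz
  have hzm : ∀ k, Measurable (z k) := fun k => (hwm k).indicator (hEm k)
  have hzmono : Monotone z := by
    intro i j hij y
    simp only [hz]
    by_cases hy : y ∈ E i
    · rw [Set.indicator_of_mem hy, Set.indicator_of_mem (hEmono hij hy)]
      exact hwmono hij y
    · rw [Set.indicator_of_notMem hy]; exact bot_le
  have hzq : ∀ k, (fun y => z k y ^ q) = (E k).indicator (fun y => w k y ^ q) := by
    intro k
    ext y
    by_cases hy : y ∈ E k
    · simp [hz, hy]
    · simp [hz, hy, hq]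
  have hwT : ∀ k y, w k y ≤ TT a d q τ (z k) y := by
    intro k y
    refine (h (τ.restrict (E k)) inferInstance y).trans (le_of_eq ?_)
    unfold TT
    rw [hzq, withDensity_indicator (hEm k)]
  have hzw : ∀ k y, z k y ≤ w k y := fun k y => Set.indicator_le_self _ _ y
  -- integral step
  have hstep : ∀ f : X → ℝ≥0∞, ∫⁻ y, f y ^ q ∂τ ≠ ∞ →
      ∫⁻ y, TT a d q τ f y ^ q ∂τ ≤ K ^ q * (∫⁻ y, f y ^ q ∂τ) ^ (q * a) := by
    intro f hf
    have hfu : (τ.withDensity fun y => f y ^ q) Set.univ = ∫⁻ y, f y ^ q ∂τ := by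
      rw [withDensity_apply _ MeasurableSet.univ, Measure.restrict_univ]
    have : IsFiniteMeasure (τ.withDensity fun y => f y ^ q) :=
      ⟨by rw [hfu]; exact lt_top_iff_ne_top.2 hf⟩
    have h1 := kap_ineq ha hq σ hk (τ.withDensity fun y => f y ^ q)
    rw [hfu] at h1
    exact h1
  have hzint : ∀ k, ∫⁻ y, z k y ^ q ∂τ ≤ K ^ (q * g) := by
    intro k
    have hfin : ∫⁻ y, z k y ^ q ∂τ ≠ ∞ := by
      refine ne_top_of_le_ne_top (b := ∫⁻ y, (c * (k : ℝ≥0∞) ^ g) ^ q ∂τ) ?_ ?_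
      · rw [lintegral_const]
        exact ENNReal.mul_ne_top (by finiteness) (measure_ne_top _ _)
      · refine lintegral_mono fun y => ?_
        refine ENNReal.rpow_le_rpow ?_ hq.le
        by_cases hy : y ∈ E k
        · simp only [hz]
          rw [Set.indicator_of_mem hy]
          simp only [hw]
          gcongr
          exact (Wf_mono ha.le Measure.restrict_le_self y).trans hy
        · simp only [hz]
          rw [Set.indicator_of_notMem hy]; exact bot_le
    refine arith_bound hg0 hg hfin (le_trans ?_ (hstep _ hfin))
    refine lintegral_mono fun y => ?_
    exact ENNReal.rpow_le_rpow ((hzw k y).trans (hwT k y)) hq.le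
  set Z : X → ℝ≥0∞ := fun y => ⨆ k, z k y with hZ
  have hZm : Measurable Z := Measurable.iSup hzm
  have hZT : Z ≤ TT a d q τ Z := by
    intro y
    refine iSup_le fun k => ?_
    refine ((hzw k y).trans (hwT k y)).trans ?_
    exact TT_mono ha.le hq.le τ (fun y => le_iSup (fun k => z k y) k) y
  have hZint : ∫⁻ y, Z y ^ q ∂τ ≤ K ^ (q * g) := by
    simp only [hZ]
    simp_rw [iSup_rpow _ hq]
    rw [lintegral_iSup (fun k => (hzm k).pow_const q)
      (fun i j hij y => ENNReal.rpow_le_rpow (hzmono hij y) hq.le)]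
    exact iSup_le hzint
  have hUint : ∀ j, ∫⁻ y, UU a d q τ Z j y ^ q ∂τ ≤ K ^ (q * g) := by
    intro j
    induction j with
    | zero => exact hZint
    | succ j ih =>
      rw [UU_succ]
      refine (hstep _ (ne_top_of_le_ne_top (hKt _ (by positivity)) ih)).trans ?_
      have hqa : 0 < q * a := by positivity
      calc K ^ q * (∫⁻ y, UU a d q τ Z j y ^ q ∂τ) ^ (q * a)
          ≤ K ^ q * (K ^ (q * g)) ^ (q * a) := by gcongr
        _ = K ^ (q * g) := by
            rw [← ENNReal.rpow_mul, ← ENNReal.rpow_add_of_nonneg _ _ hq.le (by positivity)]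
            congr 1
            linear_combination -q * hg
  refine ⟨fixU a d q τ Z, measurable_fixU a d q τ hZm, fixU_eq ha hq τ hZm hZT, ?_, ?_⟩
  · intro y
    rw [fixU_eq ha hq τ hZm hZT, Wf_restrict_iSup ha τ E hEmono hEm hE0 y,
      const_mul_iSup_rpow _ _ hg0]
    refine iSup_le fun k => (hwT k y).trans ?_
    refine TT_mono ha.le hq.le τ (fun y => ?_) y
    exact (le_iSup (fun k => z k y) k).trans (le_fixU a d q τ Z y)
  · unfold fixU
    simp_rw [iSup_rpow _ hq]
    have hmono := monotone_UU ha.le hq.le τ hZT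
    rw [lintegral_iSup (fun k => (measurable_UU a d q τ hZm k).pow_const q)
      (fun i j hij y => ENNReal.rpow_le_rpow (hmono hij y) hq.le)]
    exact iSup_le hUint

end WolffAux


namespace WolffAux

set_option linter.unusedSectionVars false

variable {X : Type*} [MetricSpace X] [SecondCountableTopology X] [MeasurableSpace X] [BorelSpace X]

/-- tail of the intrinsic potential -/
noncomputable def KT (a d q g : ℝ) (σ : Measure X) (x : X) (R : ℝ) : ℝ≥0∞ :=
  II a d (fun t => kap a d q σ (Metric.ball x t) ^ (q * g)) R

/-- tail of the Wolff potential -/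
noncomputable def WT (a d : ℝ) (σ : Measure X) (x : X) (R : ℝ) : ℝ≥0∞ :=
  II a d (fun t => σ (Metric.ball x t)) R

/-- the conclusion of `kap_le` -/
def KapLe (X : Type*) [MetricSpace X] [MeasurableSpace X] (a d q g : ℝ) (C : ℝ≥0∞) : Prop :=
  ∀ (σ : Measure X) (A : Set X) (u : X → ℝ≥0∞), SFinite σ →
      MeasurableSet A → Measurable u → (∀ᵐ y ∂(σ.restrict A), u y ≠ 0 ∧ u y ≠ ∞) →
      (∀ y, Wf a d ((σ.restrict A).withDensity fun y => u y ^ q) y ≤ u y) →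
      kap a d q σ A ^ (q * g) ≤ C * ∫⁻ y in A, u y ^ q ∂σ

lemma ae_good {a d q g : ℝ} (ha : 0 < a) (hq : 0 < q) (hg0 : 0 < g) (c : ℝ≥0∞) (hc0 : c ≠ 0)
    (τ : Measure X) (u : X → ℝ≥0∞) (hu : Measurable u) (hlow : ∀ y, c * Wf a d τ y ^ g ≤ u y)
    (ρ : Measure X) (hρ : ρ ≤ τ) (hfinint : ∫⁻ y, u y ^ q ∂ρ ≠ ∞) :
    ∀ᵐ y ∂ρ, u y ≠ 0 ∧ u y ≠ ∞ := by
  have h1 : ∀ᵐ y ∂ρ, u y ≠ ∞ := by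
    filter_upwards [ae_lt_top (hu.pow_const q) hfinint] with y hy
    exact ((ENNReal.rpow_lt_top_iff_of_pos hq).1 hy).ne
  have h2 : ∀ᵐ y ∂ρ, u y ≠ 0 := by
    by_cases h0 : τ = 0
    · have : ρ = 0 := le_antisymm (h0 ▸ hρ) (Measure.zero_le _)
      simp [this]
    · refine Filter.Eventually.of_forall fun y hy => h0 ?_
      have h3 := hlow y
      rw [hy] at h3
      have h4 := le_antisymm h3 bot_le
      rcases mul_eq_zero.1 h4 with h | h
      · exact absurd h hc0
      · exact eq_zero_of_Wf_eq_zero ha τ y ((ENNReal.rpow_eq_zero_iff_of_pos hg0).1 h)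
  filter_upwards [h1, h2] with y hy1 hy2 using ⟨hy2, hy1⟩

lemma pointwise_split {a d q g : ℝ} (ha : 0 < a) (hq : 0 < q) (hg0 : 0 < g)
    (c : ℝ≥0∞) (hc0 : c ≠ 0) (hct : c ≠ ∞)
    (CK : ℝ≥0∞) (hCK : CK ≠ ∞) (hkap : KapLe X a d q g CK)
    (σ : Measure X) [SFinite σ] (x : X) {s : ℝ} (hs : 0 < s)
    (hk : kap a d q σ (Metric.ball x (2 * s)) ≠ ∞)
    (u : X → ℝ≥0∞) (hu : Measurable u)
    (hfix : ∀ y, u y = TT a d q (σ.restrict (Metric.ball x (2 * s))) u y)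
    (hlow : ∀ y, c * Wf a d (σ.restrict (Metric.ball x (2 * s))) y ^ g ≤ u y)
    (hfinint : ∫⁻ y in Metric.ball x (2 * s), u y ^ q ∂σ
      ≤ kap a d q σ (Metric.ball x (2 * s)) ^ (q * g))
    (y : X) (hy : y ∈ Metric.ball x s) :
    KT a d q g σ y 0 + Wf a d σ y ^ g ≤
      (CK ^ a + ENNReal.ofReal (2 ^ (d * a)) +
        2 ^ g * (c⁻¹ + ENNReal.ofReal (2 ^ (d * a)) ^ g)) *
      (u y + (KT a d q g σ x s + WT a d σ x s ^ g)) := by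
  set B := Metric.ball x (2 * s) with hB
  set τ := σ.restrict B with hτ
  set k : ℝ≥0∞ := ENNReal.ofReal (2 ^ (d * a)) with hkk
  have hae := ae_good ha hq hg0 c hc0 τ u hu hlow τ le_rfl
    (ne_top_of_le_ne_top (ENNReal.rpow_ne_top_of_nonneg (by positivity) hk) hfinint)
  have hsub : ∀ t, t ≤ s → Metric.ball y t ⊆ B := by
    intro t ht
    refine Metric.ball_subset_ball' ?_
    have : dist y x < s := hy
    linarith
  have hK1 : KT a d q g σ y 0 ≤ CK ^ a * u y + k * KT a d q g σ x s := by
    unfold KT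
    rw [II_split hs.le]
    refine add_le_add ?_ ?_
    · have h1 : CK ^ a * u y = II a d (fun t => CK * ∫⁻ z in Metric.ball y t, u z ^ q ∂τ) 0 := by
        rw [II_const_mul ha.le _ hCK, ← TT_eq, ← hfix]
      rw [h1]
      unfold II
      refine le_trans ?_ (lintegral_mono_set (Set.Ioc_subset_Ioi_self : Set.Ioc 0 s ⊆ Set.Ioi 0))
      refine setLIntegral_mono' measurableSet_Ioc fun t ht => ?_
      dsimp only
      have hsubt := hsub t ht.2
      gcongr
      have hrestr : τ.restrict (Metric.ball y t) = σ.restrict (Metric.ball y t) := by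
        rw [hτ, Measure.restrict_restrict measurableSet_ball, Set.inter_eq_left.2 hsubt]
      rw [hrestr]
      have hle : σ.restrict (Metric.ball y t) ≤ τ := Measure.restrict_mono hsubt le_rfl
      refine hkap σ _ u inferInstance measurableSet_ball hu (ae_mono hle hae) fun w => ?_
      rw [hfix w]
      exact TT_mono_measure ha.le hle u w
    · refine (II_tail_le ha.le hs.le (fun A => kap a d q σ A ^ (q * g))
        (fun A A' h => ENNReal.rpow_le_rpow (kap_mono hq σ h) (by positivity)) hy).trans ?_
      gcongr
      exact II_anti (by linarith)
  have hW1 : Wf a d σ y ≤ Wf a d τ y + k * WT a d σ x s := by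
    unfold Wf
    rw [II_split hs.le]
    refine add_le_add ?_ ?_
    · unfold II
      refine le_trans ?_ (lintegral_mono_set (Set.Ioc_subset_Ioi_self : Set.Ioc 0 s ⊆ Set.Ioi 0))
      refine setLIntegral_mono' measurableSet_Ioc fun t ht => ?_
      dsimp only
      rw [hτ, Measure.restrict_apply measurableSet_ball, Set.inter_eq_left.2 (hsub t ht.2)]
    · refine (II_tail_le ha.le hs.le (fun A => σ A)
        (fun A A' h => measure_mono h) hy).trans ?_
      gcongr
      exact II_anti (by linarith)
  have hW2 : Wf a d τ y ^ g ≤ c⁻¹ * u y := by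
    calc Wf a d τ y ^ g = c⁻¹ * (c * Wf a d τ y ^ g) := by
          rw [← mul_assoc, ENNReal.inv_mul_cancel hc0 hct, one_mul]
      _ ≤ _ := by gcongr; exact hlow y
  have hW3 : Wf a d σ y ^ g ≤ 2 ^ g * (c⁻¹ * u y + k ^ g * WT a d σ x s ^ g) := by
    calc Wf a d σ y ^ g ≤ (Wf a d τ y + k * WT a d σ x s) ^ g := ENNReal.rpow_le_rpow hW1 hg0.le
      _ ≤ 2 ^ g * (Wf a d τ y ^ g + (k * WT a d σ x s) ^ g) := add_rpow_le _ _ hg0.le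
      _ ≤ _ := by
        rw [ENNReal.mul_rpow_of_nonneg _ _ hg0.le]
        gcongr
  generalize KT a d q g σ x s = T1 at *
  generalize WT a d σ x s ^ g = T2 at *
  calc KT a d q g σ y 0 + Wf a d σ y ^ g
      ≤ (CK ^ a * u y + k * T1) + 2 ^ g * (c⁻¹ * u y + k ^ g * T2) := add_le_add hK1 hW3
    _ ≤ (CK ^ a * u y + k * T1) + 2 ^ g * (c⁻¹ * u y + k ^ g * T2) +
        ((CK ^ a + 2 ^ g * (c⁻¹ + k ^ g)) * T1 + (k + 2 ^ g * k ^ g) * u y +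
          (CK ^ a + k + 2 ^ g * c⁻¹) * T2) := le_self_add
    _ = _ := by ring

lemma integral_bound {a d q g : ℝ} (ha : 0 < a) (hd : 0 < d) (hq : 0 < q) (hg0 : 0 < g)
    (hg : g * (1 - q * a) = 1) (hqa : q * a < 1)
    (c : ℝ≥0∞) (hc0 : c ≠ 0) (hct : c ≠ ∞) (h : ∀ (τ : Measure X), IsFiniteMeasure τ → ∀ x,
      c * Wf a d τ x ^ g ≤ TT a d q τ (fun y => c * Wf a d τ y ^ g) x) :
    ∃ C4 : ℝ≥0∞, C4 ≠ ∞ ∧ ∀ (σ : Measure X), SFinite σ →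
      (∀ x s, σ (Metric.ball x s) ≠ ∞) → (∀ x s, kap a d q σ (Metric.ball x s) ≠ ∞) →
      ∀ (C1 : ℝ≥0∞), C1 ≠ ∞ → ∀ (f : X → ℝ≥0∞), 
        (∀ y, f y ≤ C1 * (KT a d q g σ y 0 + Wf a d σ y ^ g)) → ∀ x s, 0 < s →
        ∫⁻ y in Metric.ball x s, f y ^ q ∂σ ≤ C1 ^ q * C4 *
          (kap a d q σ (Metric.ball x (2 * s)) ^ (q * g) +
            (KT a d q g σ x s + WT a d σ x s ^ g) ^ q * σ (Metric.ball x s)) := by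
  obtain ⟨CK, -, hCK, hkap⟩ := kap_le (X := X) (d := d) ha hq hqa hg
  set C3 : ℝ≥0∞ := (CK ^ a + ENNReal.ofReal (2 ^ (d * a)) +
        2 ^ g * (c⁻¹ + ENNReal.ofReal (2 ^ (d * a)) ^ g)) with hC3
  have hC3t : C3 ≠ ∞ := by
    have : c⁻¹ ≠ ∞ := ENNReal.inv_ne_top.2 hc0
    finiteness
  refine ⟨C3 ^ q * 2 ^ q, by finiteness, ?_⟩
  intro σ hσ hball hk C1 hC1 f hf x s hs
  obtain ⟨u, hu, hfix, hlow, hfinint⟩ := local_sol ha hq hg0 hg c hct h σ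
    (Metric.ball x (2 * s)) (hball _ _) (hk _ _)
  set T := KT a d q g σ x s + WT a d σ x s ^ g with hT
  have hpt : ∀ y ∈ Metric.ball x s, f y ^ q ≤ C1 ^ q * (C3 ^ q * 2 ^ q) * (u y ^ q + T ^ q) := by
    intro y hy
    have h1 := pointwise_split ha hq hg0 c hc0 hct CK hCK hkap σ x hs (hk _ _) u hu hfix hlow
      hfinint y hy
    calc f y ^ q ≤ (C1 * (C3 * (u y + T))) ^ q := by
          refine ENNReal.rpow_le_rpow ((hf y).trans ?_) hq.le
          gcongr
      _ = C1 ^ q * (C3 ^ q * (u y + T) ^ q) := by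
          rw [ENNReal.mul_rpow_of_nonneg _ _ hq.le, ENNReal.mul_rpow_of_nonneg _ _ hq.le]
      _ ≤ C1 ^ q * (C3 ^ q * (2 ^ q * (u y ^ q + T ^ q))) := by
          gcongr
          exact add_rpow_le _ _ hq.le
      _ = _ := by ring
  calc ∫⁻ y in Metric.ball x s, f y ^ q ∂σ
      ≤ ∫⁻ y in Metric.ball x s, C1 ^ q * (C3 ^ q * 2 ^ q) * (u y ^ q + T ^ q) ∂σ :=
        setLIntegral_mono' measurableSet_ball hpt
    _ = C1 ^ q * (C3 ^ q * 2 ^ q) *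
        ((∫⁻ y in Metric.ball x s, u y ^ q ∂σ) + T ^ q * σ (Metric.ball x s)) := by
        rw [lintegral_const_mul' _ _ (by finiteness), lintegral_add_left (hu.pow_const q),
          setLIntegral_const]
    _ ≤ _ := by
        gcongr
        refine le_trans (lintegral_mono_set ?_) hfinint
        exact Metric.ball_subset_ball (by linarith)

lemma young_bound {a q g : ℝ} (ha : 0 < a) (hq : 0 < q) (hg0 : 0 < g)
    (hg : g * (1 - q * a) = 1) {T W : ℝ≥0∞} (h : W ^ g ≤ T) : T ^ (q * a) * W ≤ T := by
  have h1 : W ≤ T ^ (1 / g) := by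
    calc W = (W ^ g) ^ (1 / g) := by
          rw [← ENNReal.rpow_mul, mul_one_div_cancel hg0.ne', ENNReal.rpow_one]
      _ ≤ _ := ENNReal.rpow_le_rpow h (by positivity)
  calc T ^ (q * a) * W ≤ T ^ (q * a) * T ^ (1 / g) := by gcongr
    _ = T := by
        rw [← ENNReal.rpow_add_of_nonneg _ _ (by positivity) (by positivity)]
        have : q * a + 1 / g = 1 := by field_simp; linarith
        rw [this, ENNReal.rpow_one]

lemma TT_bound {a d q g : ℝ} (ha : 0 < a) (hd : 0 < d) (hq : 0 < q) (hg0 : 0 < g)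
    (hg : g * (1 - q * a) = 1)
    (C4 : ℝ≥0∞) (hC4 : C4 ≠ ∞) (σ : Measure X) (C1 : ℝ≥0∞) (hC1 : C1 ≠ ∞) (hC10 : C1 ≠ 0)
    (f : X → ℝ≥0∞) (x : X) (hb : ∀ s, 0 < s →
        ∫⁻ y in Metric.ball x s, f y ^ q ∂σ ≤ C1 ^ q * C4 *
          (kap a d q σ (Metric.ball x (2 * s)) ^ (q * g) +
            (KT a d q g σ x s + WT a d σ x s ^ g) ^ q * σ (Metric.ball x s))) :
    TT a d q σ f x ≤ C1 ^ (q * a) * (C4 ^ a * 2 ^ a * (ENNReal.ofReal (2 ^ (d * a)) + 1) + 1) *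
      (KT a d q g σ x 0 + Wf a d σ x ^ g) := by
  set T := KT a d q g σ x 0 + Wf a d σ x ^ g with hT
  set k : ℝ≥0∞ := ENNReal.ofReal (2 ^ (d * a)) with hkk
  by_cases hTt : T = ∞
  · rw [hTt, ENNReal.mul_top]
    · exact le_top
    · refine mul_ne_zero ?_ (by simp)
      exact (ENNReal.rpow_pos (pos_iff_ne_zero.2 hC10) hC1).ne'
  have hmono : Monotone fun s => kap a d q σ (Metric.ball x (2 * s)) ^ (q * g) := by
    intro s t hst
    refine ENNReal.rpow_le_rpow (kap_mono hq σ (Metric.ball_subset_ball ?_)) (by positivity)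
    linarith
  rw [TT_eq]
  calc II a d (fun s => ∫⁻ y in Metric.ball x s, f y ^ q ∂σ) 0
      ≤ II a d (fun s => C1 ^ q * C4 * (kap a d q σ (Metric.ball x (2 * s)) ^ (q * g) +
            T ^ q * σ (Metric.ball x s))) 0 := by
        refine II_mono ha.le fun s hs => (hb s hs).trans ?_
        gcongr
        exact add_le_add (II_anti hs.le) (ENNReal.rpow_le_rpow (II_anti hs.le) hg0.le)
    _ = (C1 ^ q * C4) ^ a * II a d (fun s => kap a d q σ (Metric.ball x (2 * s)) ^ (q * g) +
            T ^ q * σ (Metric.ball x s)) 0 := II_const_mul ha.le _ (by finiteness) _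
    _ ≤ (C1 ^ q * C4) ^ a * (2 ^ a *
        (II a d (fun s => kap a d q σ (Metric.ball x (2 * s)) ^ (q * g)) 0 +
          II a d (fun s => T ^ q * σ (Metric.ball x s)) 0)) := by
        gcongr
        exact II_add ha.le _ _ hmono.measurable
    _ = (C1 ^ q * C4) ^ a * (2 ^ a * (k * KT a d q g σ x 0 + T ^ (q * a) * Wf a d σ x)) := by
        rw [II_const_mul ha.le _ (by finiteness), ← ENNReal.rpow_mul,
          II_scale (fun s => kap a d q σ (Metric.ball x s) ^ (q * g)) two_pos le_rfl, mul_zero]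
        rfl
    _ ≤ (C1 ^ q * C4) ^ a * (2 ^ a * (k * T + T)) := by
        gcongr
        · exact le_self_add
        · exact young_bound ha hq hg0 hg le_add_self
    _ = C1 ^ (q * a) * (C4 ^ a * 2 ^ a * (k + 1)) * T := by
        rw [ENNReal.mul_rpow_of_nonneg _ _ ha.le, ← ENNReal.rpow_mul]
        ring
    _ ≤ _ := by
        gcongr
        exact le_self_add

theorem main_generic [ProperSpace X] {a d q g : ℝ} (ha : 0 < a) (hd : 0 < d) (hq : 0 < q)
    (hg0 : 0 < g) (hg : g * (1 - q * a) = 1) (hqa : q * a < 1) :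
    ∃ C : ℝ≥0∞, 0 < C ∧ C ≠ ∞ ∧ ∀ (σ : Measure X), IsLocallyFiniteMeasure σ → ∀ x0 : X,
      WT a d σ x0 1 ≠ ∞ → KT a d q g σ x0 1 ≠ ∞ →
      ∃ u : X → ℝ≥0∞, Measurable u ∧
        (∀ (x : X) (R : ℝ), 0 < R → ∫⁻ y in Metric.ball x R, u y ^ q ∂σ ≠ ∞) ∧
        (∀ x, u x = TT a d q σ u x) ∧
        (∀ x, C⁻¹ * (KT a d q g σ x 0 + Wf a d σ x ^ g) ≤ u x ∧
          u x ≤ C * (KT a d q g σ x 0 + Wf a d σ x ^ g)) := by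
  obtain ⟨CK, -, hCK, hkap⟩ := kap_le (X := X) (d := d) ha hq hqa hg
  obtain ⟨c, hc0, hct, hlow⟩ := lower_fin (X := X) ha hd hq hg0 hg
  obtain ⟨C4, hC4, hib⟩ := integral_bound ha hd hq hg0 hg hqa c hc0 hct hlow
  set C5 : ℝ≥0∞ := C4 ^ a * 2 ^ a * (ENNReal.ofReal (2 ^ (d * a)) + 1) + 1 with hC5
  have hC5t : C5 ≠ ∞ := by finiteness
  set C1 : ℝ≥0∞ := max c (C5 ^ g) with hC1
  have hC1t : C1 ≠ ∞ := by
    rw [hC1]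
    exact (max_lt (lt_top_iff_ne_top.2 hct)
      (lt_top_iff_ne_top.2 (ENNReal.rpow_ne_top_of_nonneg hg0.le hC5t))).ne
  have hC10 : C1 ≠ 0 := ((pos_iff_ne_zero.2 hc0).trans_le (le_max_left _ _)).ne'
  have hcC1 : c ≤ C1 := le_max_left _ _
  have hC15 : C1 ^ (q * a) * C5 ≤ C1 := young_bound ha hq hg0 hg (le_max_right _ _)
  have hcit : c⁻¹ ≠ ∞ := ENNReal.inv_ne_top.2 hc0
  set C : ℝ≥0∞ := CK ^ a + c⁻¹ + C1 with hC
  have hCt : C ≠ ∞ := by finiteness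
  have hCp : 0 < C := (pos_iff_ne_zero.2 hC10).trans_le le_add_self
  refine ⟨C, hCp, hCt, ?_⟩
  intro σ hσ x0 hWT hKT
  have hball : ∀ x s, σ (Metric.ball x s) ≠ ∞ := fun x s => measure_ball_lt_top.ne
  have hk : ∀ x s, kap a d q σ (Metric.ball x s) ≠ ∞ := by
    intro x s hinf
    apply hKT
    set R := max 1 (s + dist x x0) with hR
    have hsub : Metric.ball x s ⊆ Metric.ball x0 R :=
      Metric.ball_subset_ball' (le_max_right _ _)
    refine le_antisymm le_top ?_
    unfold KT
    refine le_trans ?_ (II_anti (le_max_left 1 (s + dist x x0)))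
    unfold II
    have : ∫⁻ _ in Set.Ioi R, (∞ : ℝ≥0∞) = ∞ := by
      rw [setLIntegral_const, Real.volume_Ioi]; simp
    rw [← this]
    refine setLIntegral_mono' measurableSet_Ioi fun t ht => ?_
    have ht0 : 0 < t := lt_of_lt_of_le one_pos ((le_max_left _ _).trans (le_of_lt ht))
    have h1 : kap a d q σ (Metric.ball x0 t) = ∞ := by
      refine le_antisymm le_top ?_
      rw [← hinf]
      exact kap_mono hq σ (hsub.trans (Metric.ball_subset_ball (le_of_lt ht)))
    dsimp only
    rw [h1, ENNReal.top_rpow_of_pos (by positivity), ENNReal.top_rpow_of_pos ha, ENNReal.top_mul]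
    rw [wt_eq ht0, Ne, ENNReal.ofReal_eq_zero, not_le]
    positivity
  set z : X → ℝ≥0∞ := fun y => c * Wf a d σ y ^ g with hz
  have hzm : Measurable z := ((measurable_Wf a d σ).pow_const g).const_mul c
  have hzT : z ≤ TT a d q σ z := fun x => lower_sfin ha hq hg0 c hlow σ x
  set u := fixU a d q σ z with hu
  have hum : Measurable u := measurable_fixU a d q σ hzm
  have hufix : ∀ x, u x = TT a d q σ u x := fixU_eq ha hq σ hzm hzT
  have hulow : ∀ y, c * Wf a d σ y ^ g ≤ u y := le_fixU a d q σ z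
  have hUup : ∀ j y, UU a d q σ z j y ≤ C1 * (KT a d q g σ y 0 + Wf a d σ y ^ g) := by
    intro j
    induction j with
    | zero =>
      intro y
      exact mul_le_mul' hcC1 le_add_self
    | succ j ih =>
      intro y
      rw [UU_succ]
      refine (TT_bound ha hd hq hg0 hg C4 hC4 σ C1 hC1t hC10 _ y
        fun s hs => hib σ inferInstance hball hk C1 hC1t _ ih y s hs).trans ?_
      gcongr
  have huup : ∀ y, u y ≤ C1 * (KT a d q g σ y 0 + Wf a d σ y ^ g) :=
    fun y => iSup_le fun j => hUup j y
  have hloc : ∀ (x : X) (R : ℝ), ∫⁻ y in Metric.ball x R, u y ^ q ∂σ ≠ ∞ := by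
    intro x R
    set S := max 1 (R + dist x x0) with hS
    have hS0 : 0 < S := lt_of_lt_of_le one_pos (le_max_left _ _)
    have hsub : Metric.ball x R ⊆ Metric.ball x0 S :=
      Metric.ball_subset_ball' (le_max_right _ _)
    refine ne_top_of_le_ne_top ?_ ((lintegral_mono_set hsub).trans
      (hib σ inferInstance hball hk C1 hC1t u huup x0 S hS0))
    have h1 : KT a d q g σ x0 S ≠ ∞ := ne_top_of_le_ne_top hKT (II_anti (le_max_left _ _))
    have h2 : WT a d σ x0 S ≠ ∞ := ne_top_of_le_ne_top hWT (II_anti (le_max_left _ _))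
    have h3 := hball x0 S
    have h4 := ENNReal.rpow_ne_top_of_nonneg (show 0 ≤ q * g by positivity) (hk x0 (2 * S))
    have h5 := ENNReal.rpow_ne_top_of_nonneg hg0.le h2
    have h6 := ENNReal.rpow_ne_top_of_nonneg hq.le (ENNReal.add_ne_top.2 ⟨h1, h5⟩)
    refine ENNReal.mul_ne_top (by finiteness) (ENNReal.add_ne_top.2 ⟨h4, ENNReal.mul_ne_top h6 h3⟩)
  have hKlow : ∀ x, KT a d q g σ x 0 ≤ CK ^ a * u x := by
    intro x
    have h1 : CK ^ a * u x = II a d (fun t => CK * ∫⁻ z in Metric.ball x t, u z ^ q ∂σ) 0 := by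
      rw [II_const_mul ha.le _ hCK, ← TT_eq, ← hufix]
    rw [h1]
    refine II_mono ha.le fun t _ => ?_
    refine hkap σ _ u inferInstance measurableSet_ball hum
      (ae_good ha hq hg0 c hc0 σ u hum hulow _ Measure.restrict_le_self (hloc x t)) fun w => ?_
    rw [hufix w]
    exact TT_mono_measure ha.le Measure.restrict_le_self u w
  refine ⟨u, hum, fun x R _ => hloc x R, hufix, fun x => ⟨?_, ?_⟩⟩
  · have h1 : Wf a d σ x ^ g ≤ c⁻¹ * u x := by
      calc Wf a d σ x ^ g = c⁻¹ * (c * Wf a d σ x ^ g) := by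
            rw [← mul_assoc, ENNReal.inv_mul_cancel hc0 hct, one_mul]
        _ ≤ _ := by gcongr; exact hulow x
    have h2 : KT a d q g σ x 0 + Wf a d σ x ^ g ≤ C * u x := by
      calc KT a d q g σ x 0 + Wf a d σ x ^ g ≤ CK ^ a * u x + c⁻¹ * u x :=
            add_le_add (hKlow x) h1
        _ = (CK ^ a + c⁻¹) * u x := by ring
        _ ≤ C * u x := by gcongr; exact le_self_add
    calc C⁻¹ * (KT a d q g σ x 0 + Wf a d σ x ^ g) ≤ C⁻¹ * (C * u x) := by gcongr
      _ = u x := by rw [← mul_assoc, ENNReal.inv_mul_cancel hCp.ne' hCt, one_mul]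
  · refine (huup x).trans ?_
    gcongr
    exact le_add_self

end WolffAux


lemma wolffTail_eq (n : ℕ) (p α : ℝ) (hp : 1 < p) (σ : Measure (EuclideanSpace ℝ (Fin n)))
    (x : EuclideanSpace ℝ (Fin n)) (R : ℝ) :
    wolffTail n p α σ x R = WolffAux.WT (1 / (p - 1)) ((n : ℝ) - α * p) σ x R := by
  have ha : 0 ≤ 1 / (p - 1) := one_div_nonneg.2 (by linarith)
  unfold wolffTail WolffAux.WT WolffAux.II
  exact lintegral_congr fun r => WolffAux.div_rpow_div_eq ha _

lemma wolff_eq (n : ℕ) (p α : ℝ) (hp : 1 < p) (σ : Measure (EuclideanSpace ℝ (Fin n)))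
    (x : EuclideanSpace ℝ (Fin n)) :
    wolff n p α σ x = WolffAux.Wf (1 / (p - 1)) ((n : ℝ) - α * p) σ x :=
  wolffTail_eq n p α hp σ x 0

lemma kappa_eq (n : ℕ) (p α q : ℝ) (hp : 1 < p) (σ : Measure (EuclideanSpace ℝ (Fin n)))
    (B : Set (EuclideanSpace ℝ (Fin n))) :
    kappa n p α q σ B = WolffAux.kap (1 / (p - 1)) ((n : ℝ) - α * p) q σ B := by
  unfold kappa WolffAux.kap
  simp only [wolff_eq n p α hp]

lemma kappaTail_eq (n : ℕ) (p α q : ℝ) (hp : 1 < p) (σ : Measure (EuclideanSpace ℝ (Fin n)))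
    (x : EuclideanSpace ℝ (Fin n)) (t : ℝ) :
    kappaTail n p α q σ x t
      = WolffAux.KT (1 / (p - 1)) ((n : ℝ) - α * p) q ((p - 1) / (p - 1 - q)) σ x t := by
  have ha : 0 ≤ 1 / (p - 1) := one_div_nonneg.2 (by linarith)
  unfold kappaTail WolffAux.KT WolffAux.II
  refine lintegral_congr fun r => ?_
  rw [WolffAux.div_rpow_div_eq ha, kappa_eq n p α q hp, mul_div_assoc]

theorem main_integral_equation_existence (n : ℕ) (p q α : ℝ) (hp : 1 < p)
    (hq0 : 0 < q) (hq : q < p - 1) (hα0 : 0 < α) (hα : α < n / p) :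
    ∃ C : ℝ≥0∞, 0 < C ∧ C ≠ ⊤ ∧
      ∀ (σ : Measure (EuclideanSpace ℝ (Fin n))), IsLocallyFiniteMeasure σ →
        wolffTail n p α σ 0 1 ≠ ⊤ →
        kappaTail n p α q σ 0 1 ≠ ⊤ →
        ∃ u : EuclideanSpace ℝ (Fin n) → ℝ≥0∞, Measurable u ∧
          (∀ (x : EuclideanSpace ℝ (Fin n)) (R : ℝ), 0 < R →
            ∫⁻ y in Metric.ball x R, u y ^ q ∂σ ≠ ⊤) ∧
          (∀ x : EuclideanSpace ℝ (Fin n),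
            u x = wolff n p α (σ.withDensity fun y => u y ^ q) x) ∧
          (∀ x : EuclideanSpace ℝ (Fin n),
            C⁻¹ * (Kpot n p α q σ x + wolff n p α σ x ^ ((p - 1) / (p - 1 - q))) ≤ u x ∧
            u x ≤ C * (Kpot n p α q σ x + wolff n p α σ x ^ ((p - 1) / (p - 1 - q)))) := by
  have hp1 : 0 < p - 1 := by linarith
  have hpq : 0 < p - 1 - q := by linarith
  have ha : 0 < 1 / (p - 1) := one_div_pos.2 hp1
  have hd : 0 < (n : ℝ) - α * p := by
    have := (lt_div_iff₀ (by linarith : (0 : ℝ) < p)).1 hα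
    linarith
  have hg0 : 0 < (p - 1) / (p - 1 - q) := div_pos hp1 hpq
  have hqa : q * (1 / (p - 1)) < 1 := by
    rw [mul_one_div, div_lt_one hp1]
    exact hq
  have hg : (p - 1) / (p - 1 - q) * (1 - q * (1 / (p - 1))) = 1 := by
    have h1 := hp1.ne'
    have h2 := hpq.ne'
    field_simp
  obtain ⟨C, hC0, hCt, H⟩ := WolffAux.main_generic (X := EuclideanSpace ℝ (Fin n))
    ha hd hq0 hg0 hg hqa
  refine ⟨C, hC0, hCt, fun σ hσ h1 h2 => ?_⟩
  rw [wolffTail_eq n p α hp] at h1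
  rw [kappaTail_eq n p α q hp] at h2
  obtain ⟨u, hu1, hu2, hu3, hu4⟩ := H σ hσ 0 h1 h2
  refine ⟨u, hu1, hu2, fun x => ?_, fun x => ?_⟩
  · rw [wolff_eq n p α hp]
    exact hu3 x
  · unfold Kpot
    rw [wolff_eq n p α hp, kappaTail_eq n p α q hp]
    exact hu4 x
end
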